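/- Let 0 < p < 1/2. There exists a constant c_p > 0, depending only on p and λ = sup_k m_k, such that for every martingale f ∈ H_p the strong convergence inequality Σ_{k=1}^∞ ‖σ_k f‖_{L_p(μ)}^p / k^{2−2p} ≤ c_p · ‖f‖_{H_p}^p holds. -/

import Mathlib

open MeasureTheory Complex Finset
open scoped BigOperators ENNReal NNReal

noncomputable section

instance (n : ℕ) : MeasurableSpace (ZMod n) := ⊤

/-- The Vilenkin group determined by the generating sequence `m`. -/
abbrev Gm (m : ℕ → ℕ) : Type := ∀ _k : ℕ, ZMod (m _k)

namespace Vilenkin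

variable (m : ℕ → ℕ)

/-- The generalized powers `M_0 = 1`, `M_{k+1} = m_k · M_k`. -/
def M : ℕ → ℕ
  | 0 => 1
  | k + 1 => m k * M k

/-- The `j`-th digit `n_j` of `n` in the generalized number system based on `m`. -/
def digit (n j : ℕ) : ℕ := n / M m j % m j

/-- `|n|`, the index of the highest nonzero digit of `n`. -/
def hi (n : ℕ) : ℕ := Nat.findGreatest (fun j => digit m n j ≠ 0) n

/-- `⟨n⟩`, the index of the lowest nonzero digit of `n`. -/
def lo (n : ℕ) : ℕ := sInf {j | digit m n j ≠ 0}

/-- The generalized Rademacher functions `r_k(x) = exp(2πi x_k / m_k)`. -/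
def rad (k : ℕ) (x : Gm m) : ℂ :=
  Complex.exp (2 * Real.pi * Complex.I * ((x k).val : ℂ) / (m k : ℂ))

/-- The Vilenkin functions `ψ_n = ∏_k r_k^{n_k}`. -/
def vil (n : ℕ) (x : Gm m) : ℂ :=
  ∏ k ∈ Finset.range (n + 1), rad m k x ^ digit m n k

/-- The Dirichlet kernels `D_n = ∑_{k=0}^{n-1} ψ_k`. -/
def D (n : ℕ) (x : Gm m) : ℂ := ∑ k ∈ Finset.range n, vil m k x

/-- The Fejér kernels `K_n = (1/n) ∑_{k=1}^{n} D_k`. -/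
def K (n : ℕ) (x : Gm m) : ℂ := (n : ℂ)⁻¹ * ∑ k ∈ Finset.range n, D m (k + 1) x

/-- The Nörlund kernels `F_n = (1/Q_n) ∑_{k=1}^{n} q_{n-k} D_k` where
`Q_n = ∑_{k=0}^{n-1} q_k`. -/
def FK (q : ℕ → ℝ) (n : ℕ) (x : Gm m) : ℂ :=
  ((∑ k ∈ Finset.range n, q k : ℝ) : ℂ)⁻¹ *
    ∑ k ∈ Finset.range n, (q (n - (k + 1)) : ℂ) * D m (k + 1) x

/-- The cylinder subgroup `I_n = {x : x_0 = … = x_{n-1} = 0}`. -/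
def I (n : ℕ) : Set (Gm m) := {x | ∀ k < n, x k = 0}

/-- The cylinder of length `n` around `x`. -/
def cylAt (n : ℕ) (x : Gm m) : Set (Gm m) := {y | ∀ k < n, y k = x k}

/-- `μ` is the normalized Haar measure of `G_m`: the (unique) Borel probability
measure giving each cylinder of length `n` measure `1 / M_n`. -/
def IsHaar (μ : Measure (Gm m)) : Prop :=
  ∀ (n : ℕ) (x : Gm m), μ (cylAt m n x) = (M m n : ℝ≥0∞)⁻¹

/-- A martingale with respect to the filtration `(ℱ_n)` on `G_m`, where `ℱ_n` is
generated by the first `n` coordinates: each `f n` is integrable and depends only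
on the first `n` coordinates, and the conditional expectation of `f N` with
respect to `ℱ_n` (which under the Haar measure is given by averaging over the
cylinders of length `n`) equals `f n` for `n ≤ N`. -/
structure IsMartingale (μ : Measure (Gm m)) (f : ℕ → Gm m → ℂ) : Prop where
  integrable : ∀ n, Integrable (f n) μ
  adapted : ∀ (n : ℕ) (x y : Gm m), (∀ k < n, x k = y k) → f n x = f n y
  mart : ∀ n N : ℕ, n ≤ N → ∀ x : Gm m,
    f n x = (M m n : ℂ) * ∫ t in cylAt m n x, f N t ∂μ

/-- The Vilenkin–Fourier coefficients of a martingale: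
`f̂(i) = lim_k ∫ f^(k) conj(ψ_i) dμ`; for a martingale these integrals are
constant as soon as `M_k > i`, in particular from `k = i + 1` on. -/
def coeff (μ : Measure (Gm m)) (f : ℕ → Gm m → ℂ) (i : ℕ) : ℂ :=
  ∫ x, f (i + 1) x * (starRingEnd ℂ) (vil m i x) ∂μ

/-- The partial sums `S_n f = ∑_{k=0}^{n-1} f̂(k) ψ_k`. -/
def S (μ : Measure (Gm m)) (f : ℕ → Gm m → ℂ) (n : ℕ) (x : Gm m) : ℂ :=
  ∑ k ∈ Finset.range n, coeff m μ f k * vil m k x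

/-- The Fejér means `σ_n f = (1/n) ∑_{k=1}^{n} S_k f`. -/
def sigma (μ : Measure (Gm m)) (f : ℕ → Gm m → ℂ) (n : ℕ) (x : Gm m) : ℂ :=
  (n : ℂ)⁻¹ * ∑ k ∈ Finset.range n, S m μ f (k + 1) x

/-- The Nörlund means `t_n f = (1/Q_n) ∑_{k=1}^{n} q_{n-k} S_k f`. -/
def T (μ : Measure (Gm m)) (q : ℕ → ℝ) (f : ℕ → Gm m → ℂ) (n : ℕ) (x : Gm m) : ℂ :=
  ((∑ k ∈ Finset.range n, q k : ℝ) : ℂ)⁻¹ *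
    ∑ k ∈ Finset.range n, (q (n - (k + 1)) : ℂ) * S m μ f (k + 1) x

/-- The martingale maximal function `f* = sup_n |f^(n)|`. -/
def mstar (f : ℕ → Gm m → ℂ) (x : Gm m) : ℝ≥0∞ := ⨆ n, (‖f n x‖₊ : ℝ≥0∞)

/-- The `L_p`-type quasi-norm `(∫ g^p dμ)^{1/p}` of an `ℝ≥0∞`-valued function. -/
def eLp (μ : Measure (Gm m)) (p : ℝ) (g : Gm m → ℝ≥0∞) : ℝ≥0∞ :=
  (∫⁻ x, g x ^ p ∂μ) ^ (1 / p)

/-- Membership in the martingale Hardy space `H_p`: `‖f‖_{H_p} = ‖f*‖_{L_p} < ∞`. -/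
def MemHp (μ : Measure (Gm m)) (p : ℝ) (f : ℕ → Gm m → ℂ) : Prop :=
  eLp m μ p (mstar m f) ≠ ⊤

/-- The weak-`L_p` quasi-norm `sup_{t>0} t · μ(g > t)^{1/p}`. -/
def wLp (μ : Measure (Gm m)) (p : ℝ) (g : Gm m → ℝ≥0∞) : ℝ≥0∞ :=
  ⨆ t : ℝ≥0, (t : ℝ≥0∞) * μ {x | (t : ℝ≥0∞) < g x} ^ (1 / p)

end Vilenkin

namespace Vilenkin

section Kernel

variable {m : ℕ → ℕ}

lemma M_pos (hm : ∀ k, 2 ≤ m k) (s : ℕ) : 0 < M m s := by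
  induction s with
  | zero => simp [M]
  | succ s ih => exact Nat.mul_pos (by have := hm s; omega) ih

lemma M_mono (hm : ∀ k, 2 ≤ m k) : Monotone (M m) :=
  monotone_nat_of_le_succ fun s => Nat.le_mul_of_pos_left _ (by have := hm s; omega)

lemma two_pow_le_M (hm : ∀ k, 2 ≤ m k) (s : ℕ) : 2 ^ s ≤ M m s := by
  induction s with
  | zero => simp [M]
  | succ s ih =>
    rw [pow_succ, mul_comm]
    exact Nat.mul_le_mul (hm s) ih

lemma lt_M (hm : ∀ k, 2 ≤ m k) (s : ℕ) : s < M m s :=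
  Nat.lt_two_pow_self.trans_le (two_pow_le_M hm s)

lemma M_dvd_M {j s : ℕ} (h : j ≤ s) : M m j ∣ M m s := by
  induction s, h using Nat.le_induction with
  | base => exact dvd_rfl
  | succ s _ ih => exact ih.mul_left _

lemma digit_of_lt {n j : ℕ} (h : n < M m j) : digit m n j = 0 := by
  simp [digit, Nat.div_eq_of_lt h]

lemma digit_mul_add_of_lt (hm : ∀ k, 2 ≤ m k) {a s k j : ℕ} (hj : j < s) :
    digit m (a * M m s + k) j = digit m k j := by
  obtain ⟨q, hq⟩ := M_dvd_M (m := m) (Nat.succ_le_of_lt hj)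
  have hq' : a * M m s = M m j * (m j * (a * q)) := by
    rw [hq, M]; ring
  rw [digit, digit, hq', Nat.mul_add_div (M_pos hm j), Nat.mul_add_mod]

lemma digit_mul_add_self (hm : ∀ k, 2 ≤ m k) {a s k : ℕ} (ha : a < m s) (hk : k < M m s) :
    digit m (a * M m s + k) s = a := by
  rw [digit, mul_comm a, Nat.mul_add_div (M_pos hm s), Nat.div_eq_of_lt hk, add_zero,
    Nat.mod_eq_of_lt ha]

lemma mul_add_lt_M {a s k : ℕ} (ha : a < m s) (hk : k < M m s) :
    a * M m s + k < M m (s + 1) := by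
  calc a * M m s + k < (a + 1) * M m s := by rw [add_mul, one_mul]; omega
    _ ≤ m s * M m s := Nat.mul_le_mul_right _ ha

variable (m) in
/-- The Vilenkin functions as monomials in the values `z k` of the Rademacher functions. -/
def mono (z : ℕ → ℂ) (n : ℕ) : ℂ := ∏ k ∈ range (n + 1), z k ^ digit m n k

lemma mono_eq_prod (hm : ∀ k, 2 ≤ m k) (z : ℕ → ℂ) {n L : ℕ} (h : n < M m L) :
    mono m z n = ∏ k ∈ range L, z k ^ digit m n k := by
  have key : ∀ {a b : ℕ}, n < M m a → a ≤ b →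
      ∏ k ∈ range a, z k ^ digit m n k = ∏ k ∈ range b, z k ^ digit m n k := by
    intro a b ha hab
    refine prod_subset (range_subset_range.2 hab) fun k _ hk => ?_
    rw [digit_of_lt, pow_zero]
    exact ha.trans_le (M_mono hm (by simpa using hk))
  have h1 : n < M m (n + 1) := (Nat.lt_succ_self n).trans (lt_M hm _)
  rw [mono, key h1 (le_max_left _ L), key h (le_max_right (n + 1) _)]

lemma mono_mul_add (hm : ∀ k, 2 ≤ m k) (z : ℕ → ℂ) {a s k : ℕ} (ha : a < m s)
    (hk : k < M m s) : mono m z (a * M m s + k) = z s ^ a * mono m z k := by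
  rw [mono_eq_prod hm z (mul_add_lt_M ha hk), mono_eq_prod hm z hk, prod_range_succ,
    digit_mul_add_self hm ha hk, mul_comm]
  congr 1
  refine prod_congr rfl fun j hj => ?_
  rw [digit_mul_add_of_lt hm (mem_range.1 hj)]

variable (m) in
/-- Dirichlet kernels in the variables `z`. -/
def dir (z : ℕ → ℂ) (n : ℕ) : ℂ := ∑ k ∈ range n, mono m z k

variable (m) in
/-- `n` times the Fejér kernels in the variables `z`. -/
def fej (z : ℕ → ℂ) (n : ℕ) : ℂ := ∑ k ∈ range n, dir m z (k + 1)

lemma dir_mul_add (hm : ∀ k, 2 ≤ m k) (z : ℕ → ℂ) {a s k : ℕ} (ha : a < m s)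
    (hk : k ≤ M m s) :
    dir m z (a * M m s + k) = dir m z (a * M m s) + z s ^ a * dir m z k := by
  rw [dir, sum_range_add, dir, dir, mul_sum]
  congr 1
  refine sum_congr rfl fun i hi => mono_mul_add hm z ha ((mem_range.1 hi).trans_le hk)

lemma dir_mul (hm : ∀ k, 2 ≤ m k) (z : ℕ → ℂ) {a s : ℕ} (ha : a ≤ m s) :
    dir m z (a * M m s) = (∑ b ∈ range a, z s ^ b) * dir m z (M m s) := by
  induction a with
  | zero => simp [dir]
  | succ a ih =>
    rw [add_mul, one_mul, dir_mul_add hm z ha le_rfl, ih (by omega), sum_range_succ, add_mul]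

lemma fej_mul_add (hm : ∀ k, 2 ≤ m k) (z : ℕ → ℂ) {a s r : ℕ} (ha : a < m s)
    (hr : r ≤ M m s) :
    fej m z (a * M m s + r) =
      fej m z (a * M m s) + r * dir m z (a * M m s) + z s ^ a * fej m z r := by
  have : ∀ k ∈ range r, dir m z (a * M m s + k + 1) =
      dir m z (a * M m s) + z s ^ a * dir m z (k + 1) := fun k hk => by
    rw [add_assoc]
    exact dir_mul_add hm z ha (by have := mem_range.1 hk; omega)
  rw [fej, sum_range_add, sum_congr rfl this, sum_add_distrib, ← mul_sum]
  simp [fej, add_assoc]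

/-- `z` agrees with `1` on `[0, s) \ {t}`. -/
def OneOff (z : ℕ → ℂ) (t s : ℕ) : Prop := ∀ i < s, i ≠ t → z i = 1

lemma OneOff.of_forall {z : ℕ → ℂ} {t s : ℕ} (h : ∀ i < s, z i = 1) : OneOff z t s :=
  fun i hi _ => h i hi

lemma sum_pow_eq {z : ℂ} {n : ℕ} (hz : z ^ n = 1) :
    ∑ b ∈ range n, z ^ b = if z = 1 then (n : ℂ) else 0 := by
  split_ifs with h
  · simp [h]
  · rw [geom_sum_eq h, hz, sub_self, zero_div]

open Classical in
lemma dir_M (hm : ∀ k, 2 ≤ m k) {z : ℕ → ℂ} (hz : ∀ k, z k ^ m k = 1) (s : ℕ) :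
    dir m z (M m s) = if ∀ i < s, z i = 1 then (M m s : ℂ) else 0 := by
  induction s with
  | zero => simp [dir, M, mono, digit]
  | succ s ih =>
    rw [M, dir_mul hm z le_rfl, sum_pow_eq (hz s), ih]
    simp only [Nat.forall_lt_succ_right]
    by_cases h1 : z s = 1 <;> by_cases h2 : ∀ i < s, z i = 1 <;> simp [h1, h2]

lemma norm_sum_pow_le {z : ℂ} (hz : ‖z‖ = 1) (n : ℕ) : ‖∑ b ∈ range n, z ^ b‖ ≤ n := by
  refine (norm_sum_le _ _).trans ?_
  simp [hz]

open Classical in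
/-- The term of the majorant of the Fejér kernels attached to the pair `t ≤ s`. -/
def majTerm (m : ℕ → ℕ) (z : ℕ → ℂ) (s t : ℕ) : ℝ :=
  if OneOff z t s then (M m s * M m t : ℝ) else 0

lemma majTerm_nonneg (z : ℕ → ℂ) (s t : ℕ) : 0 ≤ majTerm m z s t := by
  unfold majTerm; split_ifs <;> positivity

open Classical in
lemma norm_dir_mul_le (hm : ∀ k, 2 ≤ m k) {lam : ℕ} (hl : ∀ k, m k ≤ lam) {z : ℕ → ℂ}
    (hz : ∀ k, z k ^ m k = 1) (hz1 : ∀ k, ‖z k‖ = 1) {a s : ℕ} (ha : a ≤ m s) :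
    M m s * ‖dir m z (a * M m s)‖ ≤ lam * majTerm m z s s := by
  have h1 := norm_sum_pow_le (hz1 s) a
  have h2 : (a : ℝ) ≤ lam := by exact_mod_cast ha.trans (hl s)
  rw [dir_mul hm z ha, norm_mul, dir_M hm hz, majTerm]
  have : OneOff z s s ↔ ∀ i < s, z i = 1 :=
    ⟨fun h i hi => h i hi hi.ne, fun h => OneOff.of_forall h⟩
  rw [if_congr this rfl rfl]
  split_ifs
  · rw [Complex.norm_natCast]
    calc (M m s : ℝ) * (‖∑ b ∈ range a, z s ^ b‖ * M m s)
        = ‖∑ b ∈ range a, z s ^ b‖ * (M m s * M m s) := by ring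
      _ ≤ _ := by gcongr; exact h1.trans h2
  · simp

lemma norm_fej_mul_le (hm : ∀ k, 2 ≤ m k) {lam : ℕ} (hl : ∀ k, m k ≤ lam) {z : ℕ → ℂ}
    (hz : ∀ k, z k ^ m k = 1) (hz1 : ∀ k, ‖z k‖ = 1) {a s : ℕ} (ha : a ≤ m s) :
    ‖fej m z (a * M m s) - (∑ b ∈ range a, z s ^ b) * fej m z (M m s)‖
      ≤ a * (lam * majTerm m z s s) := by
  induction a with
  | zero => simp [fej]
  | succ a ih =>
    rw [add_mul, one_mul, fej_mul_add hm z ha le_rfl, sum_range_succ, add_mul]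
    have : fej m z (a * M m s) + M m s * dir m z (a * M m s) + z s ^ a * fej m z (M m s) -
        ((∑ b ∈ range a, z s ^ b) * fej m z (M m s) + z s ^ a * fej m z (M m s)) =
        (fej m z (a * M m s) - (∑ b ∈ range a, z s ^ b) * fej m z (M m s)) +
          M m s * dir m z (a * M m s) := by ring
    rw [this]
    have h1 := norm_dir_mul_le hm hl hz hz1 (a := a) (s := s) (by omega)
    refine (norm_add_le _ _).trans ?_
    rw [norm_mul, Complex.norm_natCast]
    push_cast
    linarith [ih (by omega)]

lemma norm_fej_M_le (hm : ∀ k, 2 ≤ m k) {lam : ℕ} (hl : ∀ k, m k ≤ lam) {z : ℕ → ℂ}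
    (hz : ∀ k, z k ^ m k = 1) (hz1 : ∀ k, ‖z k‖ = 1) (s : ℕ) :
    ‖fej m z (M m s)‖ ≤ lam ^ 2 * ∑ t ∈ range (s + 1), majTerm m z s t := by
  have hlam : (1 : ℝ) ≤ lam := by exact_mod_cast (by have := hm 0; have := hl 0; omega : 1 ≤ lam)
  induction s with
  | zero =>
    simp [fej, M, dir, mono, digit, majTerm, OneOff]
    exact_mod_cast hlam
  | succ s ih =>
    have h1 := norm_fej_mul_le hm hl hz hz1 (a := m s) (s := s) le_rfl
    have hms : (m s : ℝ) ≤ lam := by exact_mod_cast hl s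
    have hMs : (M m (s + 1) : ℝ) = m s * M m s := by simp [M]
    have hm2 : (1 : ℝ) ≤ m s := by exact_mod_cast (by have := hm s; omega : 1 ≤ m s)
    have h2 : ‖fej m z (M m (s + 1))‖ ≤ m s * (lam * majTerm m z s s) +
        ‖(∑ b ∈ range (m s), z s ^ b) * fej m z (M m s)‖ := by
      have := norm_le_norm_add_norm_sub
        ((∑ b ∈ range (m s), z s ^ b) * fej m z (M m s)) (fej m z (M m (s + 1)))
      rw [norm_sub_rev] at this
      change ‖fej m z (M m (s + 1)) - _‖ ≤ _ at h1
      linarith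
    refine h2.trans ?_
    have hA : m s * (lam * majTerm m z s s) ≤ lam ^ 2 * majTerm m z (s + 1) s := by
      have : majTerm m z s s ≤ majTerm m z (s + 1) s := by
        unfold majTerm
        split_ifs with h h'
        · rw [hMs]
          have : (0 : ℝ) ≤ M m s * M m s := by positivity
          nlinarith
        · exact absurd (fun i hi hne => h i (by omega) hne) h'
        · positivity
        · rfl
      have h0 := majTerm_nonneg (m := m) z s s
      calc m s * (lam * majTerm m z s s) ≤ lam * (lam * majTerm m z s s) := by gcongr
        _ = lam ^ 2 * majTerm m z s s := by ring
        _ ≤ _ := by gcongr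
    have hB : ‖(∑ b ∈ range (m s), z s ^ b) * fej m z (M m s)‖ ≤
        lam ^ 2 * (∑ t ∈ range s, majTerm m z (s + 1) t + majTerm m z (s + 1) (s + 1)) := by
      rw [sum_pow_eq (hz s)]
      split_ifs with h
      · rw [norm_mul, Complex.norm_natCast]
        calc (m s : ℝ) * ‖fej m z (M m s)‖
            ≤ m s * (lam ^ 2 * ∑ t ∈ range (s + 1), majTerm m z s t) := by gcongr
          _ = lam ^ 2 * (∑ t ∈ range s, m s * majTerm m z s t + m s * majTerm m z s s) := by
              rw [sum_range_succ, ← mul_sum]; ring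
          _ ≤ _ := by
              gcongr with t ht
              · unfold majTerm
                split_ifs with h1 h2
                · rw [hMs, mul_assoc]
                · refine absurd (fun i hi hne => ?_) h2
                  rcases Nat.lt_succ_iff_lt_or_eq.1 hi with hi | rfl
                  · exact h1 i hi hne
                  · exact h
                · simp only [mul_zero]; positivity
                · simp
              · unfold majTerm
                split_ifs with h1 h2
                · rw [hMs]
                  have : (0 : ℝ) ≤ m s * (M m s * M m s) := by positivity
                  nlinarith
                · refine absurd (fun i hi hne => ?_) h2
                  rcases Nat.lt_succ_iff_lt_or_eq.1 hi with hi | rfl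
                  · exact h1 i hi hi.ne
                  · exact h
                · simp only [mul_zero]; positivity
                · simp
      · simp only [zero_mul, norm_zero]
        have := majTerm_nonneg (m := m) z (s + 1) (s + 1)
        have := sum_nonneg fun t (_ : t ∈ range s) => majTerm_nonneg (m := m) z (s + 1) t
        positivity
    rw [sum_range_succ, sum_range_succ]
    linarith

/-- Majorant of the Fejér kernels. -/
lemma norm_fej_le (hm : ∀ k, 2 ≤ m k) {lam : ℕ} (hl : ∀ k, m k ≤ lam) {z : ℕ → ℂ}
    (hz : ∀ k, z k ^ m k = 1) (hz1 : ∀ k, ‖z k‖ = 1) {n N : ℕ} (hn : n < M m N) :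
    ‖fej m z n‖ ≤
      3 * lam ^ 3 * ∑ s ∈ range N, ∑ t ∈ range (s + 1), majTerm m z s t := by
  have hlam : (1 : ℝ) ≤ lam := by exact_mod_cast (by have := hm 0; have := hl 0; omega : 1 ≤ lam)
  induction N generalizing n with
  | zero =>
    have : n = 0 := by simpa [M] using hn
    simp [this, fej]
  | succ N ih =>
    set a := n / M m N with ha'
    set r := n % M m N with hr'
    have hr : r < M m N := Nat.mod_lt _ (M_pos hm N)
    have ha : a < m N := (Nat.div_lt_iff_lt_mul (M_pos hm N)).2 hn
    have hna : n = a * M m N + r := by rw [mul_comm]; exact (Nat.div_add_mod _ _).symm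
    rw [hna, fej_mul_add hm z ha hr.le, sum_range_succ]
    set Sg := ∑ t ∈ range (N + 1), majTerm m z N t with hS
    have hNN : majTerm m z N N ≤ Sg := single_le_sum (f := fun t => majTerm m z N t)
      (fun t _ => majTerm_nonneg z N t) (by simp)
    have h0 := majTerm_nonneg (m := m) z N N
    have haL : (a : ℝ) ≤ lam := by exact_mod_cast ha.le.trans (hl N)
    have h1 : ‖fej m z (a * M m N)‖ ≤ lam ^ 2 * Sg + lam ^ 3 * Sg := by
      have e1 := norm_fej_mul_le hm hl hz hz1 ha.le
      have e2 := norm_sum_pow_le (hz1 N) a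
      have e3 := norm_fej_M_le hm hl hz hz1 N
      have := norm_le_norm_add_norm_sub
        ((∑ b ∈ range a, z N ^ b) * fej m z (M m N)) (fej m z (a * M m N))
      rw [norm_sub_rev, norm_mul] at this
      refine this.trans ?_
      rw [add_comm]
      refine add_le_add (e1.trans ?_) ?_
      · calc (a : ℝ) * (lam * majTerm m z N N) ≤ lam * (lam * Sg) := by gcongr
          _ = _ := by ring
      · calc _ ≤ (lam : ℝ) * (lam ^ 2 * Sg) := by
              gcongr
              exact e2.trans haL
          _ = _ := by ring
    have h2 : ‖(r : ℂ) * dir m z (a * M m N)‖ ≤ lam * Sg := by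
      rw [norm_mul, Complex.norm_natCast]
      have := norm_dir_mul_le hm hl hz hz1 ha.le
      calc (r : ℝ) * ‖dir m z (a * M m N)‖ ≤ M m N * ‖dir m z (a * M m N)‖ := by gcongr
        _ ≤ _ := this.trans (by gcongr)
    have h3 := ih hr
    rw [← one_mul ‖fej m z r‖, ← one_pow a, ← hz1 N, ← norm_pow, ← norm_mul] at h3
    have hS0 : 0 ≤ Sg := h0.trans hNN
    have q1 : (lam : ℝ) * Sg ≤ lam ^ 3 * Sg := by
      gcongr; nlinarith [pow_le_pow_right₀ hlam (show 1 ≤ 3 by norm_num)]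
    have q2 : (lam : ℝ) ^ 2 * Sg ≤ lam ^ 3 * Sg := by
      gcongr; norm_num
    calc _ ≤ ‖fej m z (a * M m N)‖ + ‖(r : ℂ) * dir m z (a * M m N)‖ + ‖z N ^ a * fej m z r‖ :=
          norm_add₃_le
      _ ≤ _ := by rw [mul_add]; linarith

lemma norm_fej_le_sum_ite (hm : ∀ k, 2 ≤ m k) {lam : ℕ} (hl : ∀ k, m k ≤ lam) {z : ℕ → ℂ}
    (hz : ∀ k, z k ^ m k = 1) (hz1 : ∀ k, ‖z k‖ = 1) (n : ℕ) :
    ‖fej m z n‖ ≤ 3 * lam ^ 3 * ∑ s ∈ range n with M m s ≤ n,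
      ∑ t ∈ range (s + 1), majTerm m z s t := by
  have hex : ∃ N, n < M m N := ⟨n, lt_M hm n⟩
  refine (norm_fej_le hm hl hz hz1 (Nat.find_spec hex)).trans ?_
  refine mul_le_mul_of_nonneg_left ?_ (by positivity)
  refine sum_le_sum_of_subset_of_nonneg (fun s hs => ?_)
    fun s _ _ => sum_nonneg fun t _ => majTerm_nonneg z s t
  have hs := mem_range.1 hs
  simp only [mem_filter, mem_range]
  exact ⟨hs.trans_le (Nat.find_le (lt_M hm n)), not_lt.1 (Nat.find_min hex hs)⟩

end Kernel

end Vilenkin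

namespace Vilenkin

section Cylinders

variable {m : ℕ → ℕ}

lemma mem_cylAt {n : ℕ} {x y : Gm m} : y ∈ cylAt m n x ↔ ∀ k < n, y k = x k := Iff.rfl

lemma measurableSet_cylAt (n : ℕ) (x : Gm m) : MeasurableSet (cylAt m n x) := by
  have : cylAt m n x = ⋂ k ∈ Set.Iio n, (fun y : Gm m => y k) ⁻¹' {x k} := by
    ext y; simp [cylAt]
  rw [this]
  refine MeasurableSet.biInter (Set.to_countable _) fun k _ => measurable_pi_apply k ?_
  trivial

/-- `g` depends only on the first `n` coordinates. -/
def Dep {β : Type*} (n : ℕ) (g : Gm m → β) : Prop :=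
  ∀ x y : Gm m, (∀ k < n, x k = y k) → g x = g y

lemma Dep.mono {β : Type*} {n N : ℕ} {g : Gm m → β} (h : Dep n g) (hn : n ≤ N) : Dep N g :=
  fun x y hxy => h x y fun k hk => hxy k (hk.trans_le hn)

lemma Dep.comp₂ {β γ δ : Type*} {n : ℕ} {g : Gm m → β} {h : Gm m → γ} (hg : Dep n g)
    (hh : Dep n h) (F : β → γ → δ) : Dep n fun x => F (g x) (h x) := fun x y hxy => by
  simp only [hg x y hxy, hh x y hxy]

lemma dep_mem_cylAt (n : ℕ) (c : Gm m) : Dep n fun x => x ∈ cylAt m n c := fun x y hxy => by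
  simp only [mem_cylAt, eq_iff_iff]
  exact forall₂_congr fun k hk => by rw [hxy k hk]

/-- Replace all coordinates from `n` on by `0`. -/
def trunc (n : ℕ) (x : Gm m) : Gm m := fun k => if k < n then x k else 0

lemma trunc_apply {n k : ℕ} (h : k < n) (x : Gm m) : trunc n x k = x k := if_pos h

lemma finite_range_trunc (hm : ∀ k, 2 ≤ m k) (n : ℕ) :
    (Set.range (trunc (m := m) n)).Finite := by
  have : ∀ k, NeZero (m k) := fun k => ⟨by have := hm k; omega⟩
  refine (Set.finite_range fun c : (∀ k : Fin n, ZMod (m k)) =>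
    (fun k => if h : k < n then c ⟨k, h⟩ else 0 : Gm m)).subset ?_
  rintro _ ⟨x, rfl⟩
  exact ⟨fun k => x k, funext fun k => by simp [trunc]⟩

/-- Representatives of the cylinders of length `n`. -/
def reps (hm : ∀ k, 2 ≤ m k) (n : ℕ) : Finset (Gm m) := (finite_range_trunc hm n).toFinset

lemma trunc_mem_reps (hm : ∀ k, 2 ≤ m k) (n : ℕ) (x : Gm m) : trunc n x ∈ reps hm n := by
  simp [reps]

lemma mem_cylAt_iff_of_mem_reps {hm : ∀ k, 2 ≤ m k} {n : ℕ} {c : Gm m} (hc : c ∈ reps hm n)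
    (x : Gm m) : x ∈ cylAt m n c ↔ c = trunc n x := by
  obtain ⟨y, rfl⟩ : ∃ y, trunc n y = c := by simpa [reps] using hc
  refine ⟨fun h => funext fun k => ?_, fun h => h ▸ fun k hk => (trunc_apply hk x).symm⟩
  by_cases hk : k < n
  · rw [trunc_apply hk x, h k hk]
  · simp [trunc, hk]

lemma Dep.trunc_eq {β : Type*} {n : ℕ} {g : Gm m → β} (h : Dep n g) (x : Gm m) :
    g (trunc n x) = g x := h _ _ fun _ hk => trunc_apply hk x

open Classical in
lemma sum_reps {β : Type*} [AddCommMonoid β] (hm : ∀ k, 2 ≤ m k) (n : ℕ) (g : Gm m → β)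
    (x : Gm m) :
    ∑ c ∈ reps hm n, (if x ∈ cylAt m n c then g c else 0) = g (trunc n x) := by
  have : ∀ c ∈ reps hm n, (if x ∈ cylAt m n c then g c else 0) =
      if c = trunc n x then g c else 0 := fun c hc =>
    if_congr (mem_cylAt_iff_of_mem_reps hc x) rfl rfl
  rw [sum_congr rfl this, sum_ite_eq', if_pos (trunc_mem_reps hm n x)]

lemma Dep.measurable {β : Type*} [MeasurableSpace β] (hm : ∀ k, 2 ≤ m k) {n : ℕ}
    {g : Gm m → β} (h : Dep n g) : Measurable g := by
  intro s _
  have : g ⁻¹' s = ⋃ c ∈ {c | c ∈ reps hm n ∧ g c ∈ s}, cylAt m n c := by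
    ext x
    simp only [Set.mem_preimage, Set.mem_ofPred_eq, Set.mem_iUnion, exists_prop]
    refine ⟨fun hx => ⟨trunc n x, ⟨trunc_mem_reps hm n x, by rwa [h.trunc_eq]⟩,
      fun k hk => (trunc_apply hk x).symm⟩, ?_⟩
    rintro ⟨c, ⟨_, hc⟩, hx⟩
    rwa [h x c hx]
  rw [this]
  exact MeasurableSet.biUnion ((reps hm n).finite_toSet.subset fun c hc => hc.1).countable
    fun c _ => measurableSet_cylAt n c

lemma Dep.exists_bound (hm : ∀ k, 2 ≤ m k) {n : ℕ} {g : Gm m → ℂ} (h : Dep n g) :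
    ∃ B : ℝ, ∀ x, ‖g x‖ ≤ B := by
  refine ⟨∑ c ∈ reps hm n, ‖g c‖, fun x => ?_⟩
  rw [← h.trunc_eq]
  exact single_le_sum (f := fun c => ‖g c‖) (fun _ _ => norm_nonneg _) (trunc_mem_reps hm n x)

variable {μ : Measure (Gm m)}

lemma IsHaar.isProbabilityMeasure (hμ : IsHaar m μ) : IsProbabilityMeasure μ := by
  refine ⟨?_⟩
  have := hμ 0 0
  simpa [cylAt, M] using this

lemma Dep.integrable (hm : ∀ k, 2 ≤ m k) (hμ : IsHaar m μ) {n : ℕ} {g : Gm m → ℂ}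
    (h : Dep n g) : Integrable g μ := by
  have := hμ.isProbabilityMeasure
  obtain ⟨B, hB⟩ := h.exists_bound hm
  exact Integrable.of_bound (h.measurable hm).aestronglyMeasurable B (ae_of_all _ hB)

lemma integral_eq_sum_cylAt (hm : ∀ k, 2 ≤ m k) (n : ℕ) {g : Gm m → ℂ} (hg : Integrable g μ) :
    ∫ x, g x ∂μ = ∑ c ∈ reps hm n, ∫ x in cylAt m n c, g x ∂μ := by
  have : ∀ x, g x = ∑ c ∈ reps hm n, (cylAt m n c).indicator g x := fun x => by
    classical
    have := sum_reps hm n (fun _ => g x) x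
    simpa [Set.indicator_apply] using this.symm
  rw [integral_congr_ae (ae_of_all _ this),
    integral_finsetSum _ fun c _ => hg.indicator (measurableSet_cylAt n c)]
  exact sum_congr rfl fun c _ => integral_indicator (measurableSet_cylAt n c)

lemma IsMartingale.dep {f : ℕ → Gm m → ℂ} (hf : IsMartingale m μ f) (n : ℕ) : Dep n (f n) :=
  hf.adapted n

lemma IsMartingale.integral_mul (hm : ∀ k, 2 ≤ m k) (hμ : IsHaar m μ) {f : ℕ → Gm m → ℂ}
    (hf : IsMartingale m μ f) {n N : ℕ} (hn : n ≤ N) {h : Gm m → ℂ} (hh : Dep n h) :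
    ∫ x, f N x * h x ∂μ = ∫ x, f n x * h x ∂μ := by
  have key : ∀ L, n ≤ L → ∫ x, f L x * h x ∂μ =
      ∑ c ∈ reps hm n, (M m n : ℂ)⁻¹ * f n c * h c := fun L hL => by
    have hi : Integrable (fun x => f L x * h x) μ :=
      ((hf.dep L).comp₂ (hh.mono hL) (· * ·)).integrable hm hμ
    rw [integral_eq_sum_cylAt hm n hi]
    refine sum_congr rfl fun c _ => ?_
    have hM : (M m n : ℂ) ≠ 0 := by exact_mod_cast (M_pos hm n).ne'
    rw [setIntegral_congr_fun (g := fun x => f L x * h c) (measurableSet_cylAt n c)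
      fun x hx => by simp only [hh x c hx], integral_mul_const, hf.mart n L hL c,
      inv_mul_cancel_left₀ hM]
  rw [key N hn, key n le_rfl]

/-- Points agreeing with `x` on `[0, s) \ {t}`. -/
def cylOff (t s : ℕ) (x : Gm m) : Set (Gm m) := {y | ∀ i < s, i ≠ t → x i = y i}

lemma measurableSet_cylOff (hm : ∀ k, 2 ≤ m k) (t s : ℕ) (x : Gm m) :
    MeasurableSet (cylOff t s x) := by
  have : Dep s fun y => y ∈ cylOff t s x := fun y y' h => by
    simp only [cylOff, Set.mem_ofPred_eq, eq_iff_iff]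
    exact forall₂_congr fun k hk => by rw [h k hk]
  exact measurableSet_setOfPred.2 (this.measurable hm)

lemma measure_cylOff_le (hm : ∀ k, 2 ≤ m k) {lam : ℕ} (hl : ∀ k, m k ≤ lam) (hμ : IsHaar m μ)
    (t s : ℕ) (x : Gm m) : μ (cylOff t s x) ≤ lam * (M m s : ℝ≥0∞)⁻¹ := by
  have : ∀ k, NeZero (m k) := fun k => ⟨by have := hm k; omega⟩
  have hsub : cylOff t s x ⊆ ⋃ v : ZMod (m t), cylAt m s (Function.update x t v) := fun y hy => by
    refine Set.mem_iUnion.2 ⟨y t, fun k hk => ?_⟩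
    by_cases h : k = t
    · subst h; simp
    · rw [Function.update_of_ne h, hy k hk h]
  refine (measure_mono hsub).trans ((measure_iUnion_le _).trans ?_)
  simp only [hμ s, tsum_fintype, sum_const, card_univ, ZMod.card, nsmul_eq_mul]
  gcongr
  exact hl t

end Cylinders

section Characters

variable {m : ℕ → ℕ}

lemma rad_pow (hm : ∀ k, 2 ≤ m k) (k : ℕ) (x : Gm m) : rad m k x ^ m k = 1 := by
  have : (m k : ℂ) ≠ 0 := by exact_mod_cast (by have := hm k; omega : m k ≠ 0)
  rw [rad, ← Complex.exp_nat_mul, mul_div_cancel₀ _ this, Complex.exp_eq_one_iff]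
  exact ⟨(x k).val, by push_cast; ring⟩

lemma norm_rad (hm : ∀ k, 2 ≤ m k) (k : ℕ) (x : Gm m) : ‖rad m k x‖ = 1 :=
  Complex.norm_eq_one_of_pow_eq_one (rad_pow hm k x) (by have := hm k; omega)

lemma rad_injective (hm : ∀ k, 2 ≤ m k) {k : ℕ} {x y : Gm m} (h : rad m k x = rad m k y) :
    x k = y k := by
  have : ∀ k, NeZero (m k) := fun k => ⟨by have := hm k; omega⟩
  have h0 : m k ≠ 0 := NeZero.ne _
  have hp := Complex.isPrimitiveRoot_exp (m k) h0
  have hr : ∀ w : Gm m, rad m k w = Complex.exp (2 * Real.pi * Complex.I / m k) ^ (w k).val :=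
    fun w => by rw [rad, ← Complex.exp_nat_mul]; congr 1; ring
  rw [hr, hr] at h
  exact ZMod.val_injective _ (hp.pow_inj (ZMod.val_lt _) (ZMod.val_lt _) h)

/-- The values of the Rademacher functions at `x - y`. -/
def radSub (x y : Gm m) (k : ℕ) : ℂ := rad m k x * (starRingEnd ℂ) (rad m k y)

lemma radSub_pow (hm : ∀ k, 2 ≤ m k) (x y : Gm m) (k : ℕ) : radSub x y k ^ m k = 1 := by
  rw [radSub, mul_pow, ← map_pow, rad_pow hm, rad_pow hm, map_one, one_mul]

lemma norm_radSub (hm : ∀ k, 2 ≤ m k) (x y : Gm m) (k : ℕ) : ‖radSub x y k‖ = 1 := by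
  rw [radSub, norm_mul, RCLike.norm_conj, norm_rad hm, norm_rad hm, one_mul]

lemma eq_of_radSub_eq_one (hm : ∀ k, 2 ≤ m k) {x y : Gm m} {k : ℕ} (h : radSub x y k = 1) :
    x k = y k := by
  refine rad_injective hm ?_
  have h1 : (starRingEnd ℂ) (rad m k y) * rad m k y = 1 := by
    rw [Complex.conj_mul', norm_rad hm]; simp
  calc rad m k x = radSub x y k * rad m k y := by rw [radSub, mul_assoc, h1, mul_one]
    _ = _ := by rw [h, one_mul]

lemma vil_mul_conj (x y : Gm m) (n : ℕ) :
    vil m n x * (starRingEnd ℂ) (vil m n y) = mono m (radSub x y) n := by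
  rw [vil, vil, map_prod, ← prod_mul_distrib]
  exact prod_congr rfl fun k _ => by rw [map_pow, ← mul_pow, radSub]

lemma dep_vil (hm : ∀ k, 2 ≤ m k) {n L : ℕ} (h : n < M m L) : Dep L (vil m n) := by
  intro x y hxy
  have e : ∀ w : Gm m, vil m n w = mono m (fun k => rad m k w) n := fun w => rfl
  rw [e, e, mono_eq_prod hm _ h, mono_eq_prod hm _ h]
  refine prod_congr rfl fun k hk => ?_
  simp only [rad, hxy k (mem_range.1 hk)]

end Characters

end Vilenkin

namespace Vilenkin

section RealEstimates

lemma rpow_neg_three_halves_le {x : ℝ} (hx : 1 ≤ x) :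
    x ^ (-(3 / 2) : ℝ) ≤ 5 * ((√x)⁻¹ - (√(x + 1))⁻¹) := by
  have hx0 : 0 < x := by linarith
  have ha : 0 < √x := Real.sqrt_pos.2 hx0
  have hb : 0 < √(x + 1) := Real.sqrt_pos.2 (by linarith)
  have ha2 : √x ^ 2 = x := Real.sq_sqrt hx0.le
  have hb2 : √(x + 1) ^ 2 = x + 1 := Real.sq_sqrt (by linarith)
  have e : x ^ (-(3 / 2) : ℝ) = (√x ^ 3)⁻¹ := by
    rw [Real.sqrt_eq_rpow, ← Real.rpow_natCast, ← Real.rpow_mul hx0.le, ← Real.rpow_neg hx0.le]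
    norm_num
  rw [e]
  set a := √x
  set b := √(x + 1)
  have hba : b ≤ 3 / 2 * a := by nlinarith
  have h1 : (b - a) * (b + a) = 1 := by nlinarith
  have hab : a ≤ b := by nlinarith
  have key : b ≤ 5 * (b - a) * a ^ 2 := by
    have h2 : b * (b + a) ≤ 5 * a ^ 2 := by nlinarith
    have h3 : b * (b + a) ≤ 5 * (b - a) * a ^ 2 * (b + a) := by nlinarith
    exact le_of_mul_le_mul_right h3 (by positivity)
  have : 5 * (a⁻¹ - b⁻¹) - (a ^ 3)⁻¹ = (5 * (b - a) * a ^ 2 - b) / (a ^ 3 * b) := by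
    field_simp
  have : 0 ≤ (5 * (b - a) * a ^ 2 - b) / (a ^ 3 * b) := div_nonneg (by linarith) (by positivity)
  linarith

lemma sum_rpow_tail_le {p : ℝ} (hp1 : p < 1 / 2) {X : ℕ} (hX : 1 ≤ X) (n : ℕ) :
    ∑ k ∈ range n, (if X ≤ k + 1 then ((k + 1 : ℕ) : ℝ) ^ (p - 2) else 0) ≤
      5 * (X : ℝ) ^ (p - 1) := by
  have hX0 : (0 : ℝ) < X := by exact_mod_cast hX
  have key : ∑ k ∈ range n, (if X ≤ k + 1 then ((k + 1 : ℕ) : ℝ) ^ (p - 2) else 0) ≤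
      (X : ℝ) ^ (p - 1 / 2) *
        (5 * ((√(X : ℝ))⁻¹ - (√((max X (n + 1) : ℕ) : ℝ))⁻¹)) := by
    induction n with
    | zero => simp [max_eq_left hX]
    | succ n ih =>
      rw [sum_range_succ]
      split_ifs with h
      · rw [max_eq_right h] at ih
        rw [max_eq_right (h.trans (Nat.le_succ _))]
        have h1 : (1 : ℝ) ≤ ((n + 1 : ℕ) : ℝ) := by push_cast; linarith [n.cast_nonneg (α := ℝ)]
        have hXn : (X : ℝ) ≤ ((n + 1 : ℕ) : ℝ) := by exact_mod_cast h
        have h2 := rpow_neg_three_halves_le h1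
        have h3 : ((n + 1 : ℕ) : ℝ) ^ (p - 2) ≤ (X : ℝ) ^ (p - 1 / 2) *
            ((n + 1 : ℕ) : ℝ) ^ (-(3 / 2) : ℝ) := by
          have : p - 2 = (p - 1 / 2) + -(3 / 2) := by ring
          rw [this, Real.rpow_add (by linarith)]
          gcongr ?_ * _
          exact Real.rpow_le_rpow_of_nonpos hX0 hXn (by linarith)
        have h4 := mul_le_mul_of_nonneg_left h2 (Real.rpow_nonneg hX0.le (p - 1 / 2))
        push_cast at *
        linarith
      · rw [max_eq_left (by omega)] at ih ⊢
        linarith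
  refine key.trans ?_
  calc _ ≤ (X : ℝ) ^ (p - 1 / 2) * (5 * (√(X : ℝ))⁻¹) := by
        gcongr
        exact sub_le_self _ (by positivity)
    _ = 5 * ((X : ℝ) ^ (p - 1 / 2) * (X : ℝ) ^ (-(1 / 2) : ℝ)) := by
        rw [Real.sqrt_eq_rpow, Real.rpow_neg hX0.le]; ring
    _ = _ := by rw [← Real.rpow_add hX0]; norm_num [sub_eq_add_neg, add_assoc]

lemma tsum_rpow_tail_le {p : ℝ} (hp1 : p < 1 / 2) {X : ℕ} (hX : 1 ≤ X) :
    ∑' k : ℕ, (if X ≤ k + 1 then ENNReal.ofReal (((k + 1 : ℕ) : ℝ) ^ (p - 2)) else 0) ≤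
      ENNReal.ofReal (5 * (X : ℝ) ^ (p - 1)) := by
  refine ENNReal.tsum_le_of_sum_range_le fun n => ?_
  refine le_trans (le_of_eq ?_) (ENNReal.ofReal_le_ofReal (sum_rpow_tail_le hp1 hX n))
  rw [ENNReal.ofReal_sum_of_nonneg fun k _ => by positivity]
  exact sum_congr rfl fun k _ => by split_ifs <;> simp

lemma term_le {p : ℝ} (hp0 : 0 < p) {a b w l : ℝ} (hb : 0 < b) (hba : b ≤ a)
    (hw : 0 < w) (hl : 0 ≤ l) :
    (a * b * (l / max a w)) ^ p * (l / min a w) * max a w ^ (p - 1) ≤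
      l ^ p * l / w * a ^ (2 * p - 1) := by
  have ha : 0 < a := hb.trans_le hba
  have hX : 0 < max a w := lt_max_of_lt_left ha
  have hY : 0 < min a w := lt_min ha hw
  have hXY : max a w * min a w = a * w := max_mul_min a w
  have e1 : (a * b * (l / max a w)) ^ p = (a * b) ^ p * l ^ p / max a w ^ p := by
    rw [Real.mul_rpow (by positivity) (by positivity), Real.div_rpow hl hX.le, mul_div_assoc]
  have e2 : (a * b * (l / max a w)) ^ p * (l / min a w) * max a w ^ (p - 1) =
      (a * b) ^ p * l ^ p * l / (a * w) := by
    rw [e1, Real.rpow_sub_one hX.ne', ← hXY]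
    have : max a w ^ p ≠ 0 := (Real.rpow_pos_of_pos hX p).ne'
    field_simp
  have e3 : a ^ (2 * p - 1) = (a * a) ^ p / a := by
    rw [Real.rpow_sub_one ha.ne', Real.mul_rpow ha.le ha.le, ← Real.rpow_add ha, two_mul]
  rw [e2, e3]
  have h : (a * b) ^ p ≤ (a * a) ^ p := by gcongr
  calc (a * b) ^ p * l ^ p * l / (a * w) ≤ (a * a) ^ p * l ^ p * l / (a * w) := by gcongr
    _ = _ := by field_simp

lemma ennreal_rpow_sum_le {ι : Type*} (s : Finset ι) (f : ι → ℝ≥0∞) {p : ℝ} (hp0 : 0 < p)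
    (hp1 : p ≤ 1) : (∑ i ∈ s, f i) ^ p ≤ ∑ i ∈ s, f i ^ p := by
  classical
  induction s using Finset.induction_on with
  | empty => simp [hp0]
  | insert i s hi ih =>
    rw [sum_insert hi, sum_insert hi]
    exact (ENNReal.rpow_add_le_add_rpow _ _ hp0.le hp1).trans (add_le_add le_rfl ih)

end RealEstimates

end Vilenkin

namespace Vilenkin

section Energy

variable {m : ℕ → ℕ} {μ : Measure (Gm m)}

variable (μ) in
/-- The Vilenkin-Fourier coefficients of a function. -/
def coeffFun (g : Gm m → ℂ) (i : ℕ) : ℂ := ∫ y, g y * (starRingEnd ℂ) (vil m i y) ∂μ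

variable (μ) in
/-- The Fejér means of a function. -/
def fejerMean (g : Gm m → ℂ) (n : ℕ) (x : Gm m) : ℂ :=
  (n : ℂ)⁻¹ * ∑ k ∈ range n, ∑ i ∈ range (k + 1), coeffFun μ g i * vil m i x

variable (μ) in
/-- The sum to be estimated, for the Fejér means of a function. -/
def energy (p : ℝ) (g : Gm m → ℂ) : ℝ≥0∞ :=
  ∑' k : ℕ, (∫⁻ x, ‖fejerMean μ g (k + 1) x‖ₑ ^ p ∂μ) / ((k + 1 : ℕ) : ℝ≥0∞) ^ (2 - 2 * p)

lemma dep_conj_vil (hm : ∀ k, 2 ≤ m k) {n L : ℕ} (h : n < M m L) :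
    Dep L fun x => (starRingEnd ℂ) (vil m n x) := fun x y hxy =>
  congrArg _ (dep_vil hm h x y hxy)

lemma sigma_eq_fejerMean (hm : ∀ k, 2 ≤ m k) (hμ : IsHaar m μ) {f : ℕ → Gm m → ℂ}
    (hf : IsMartingale m μ f) {n L : ℕ} (hn : n ≤ L) (x : Gm m) :
    sigma m μ f n x = fejerMean μ (f L) n x := by
  simp only [sigma, fejerMean, S]
  congr 1
  refine sum_congr rfl fun k hk => sum_congr rfl fun i hi => ?_
  simp only [mem_range] at hk hi
  rw [coeff, coeffFun, hf.integral_mul hm hμ (by omega : i + 1 ≤ L)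
    (dep_conj_vil hm ((Nat.lt_succ_self i).trans (lt_M hm _)))]

lemma integrable_mul_conj_vil (hm : ∀ k, 2 ≤ m k) (hμ : IsHaar m μ) {L : ℕ} {g : Gm m → ℂ}
    (hg : Dep L g) (i : ℕ) : Integrable (fun y => g y * (starRingEnd ℂ) (vil m i y)) μ :=
  ((hg.mono (le_max_left L i)).comp₂ (dep_conj_vil hm ((lt_M hm i).trans_le
    (M_mono hm (le_max_right L i)))) (· * ·)).integrable hm hμ

lemma fejerMean_add (hm : ∀ k, 2 ≤ m k) (hμ : IsHaar m μ) {L : ℕ} {g h : Gm m → ℂ}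
    (hg : Dep L g) (hh : Dep L h) (n : ℕ) (x : Gm m) :
    fejerMean μ (fun y => g y + h y) n x = fejerMean μ g n x + fejerMean μ h n x := by
  have : ∀ i, coeffFun μ (fun y => g y + h y) i = coeffFun μ g i + coeffFun μ h i := fun i => by
    simp only [coeffFun, add_mul]
    exact integral_add (integrable_mul_conj_vil hm hμ hg i) (integrable_mul_conj_vil hm hμ hh i)
  simp only [fejerMean, this, add_mul, sum_add_distrib, mul_add]

lemma measurable_fejerMean (hm : ∀ k, 2 ≤ m k) (g : Gm m → ℂ) (n : ℕ) :
    Measurable (fejerMean μ g n) := by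
  have : ∀ i, Measurable (vil m i) := fun i => (dep_vil hm (lt_M hm i)).measurable hm
  unfold fejerMean
  fun_prop

lemma energy_add_le (hm : ∀ k, 2 ≤ m k) (hμ : IsHaar m μ) {p : ℝ} (hp0 : 0 < p) (hp1 : p ≤ 1)
    {L : ℕ} {g h : Gm m → ℂ} (hg : Dep L g) (hh : Dep L h) :
    energy μ p (fun y => g y + h y) ≤ energy μ p g + energy μ p h := by
  rw [energy, energy, energy, ← ENNReal.tsum_add]
  refine ENNReal.tsum_le_tsum fun k => ?_
  rw [← ENNReal.add_div, ← lintegral_add_left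
    (((measurable_fejerMean hm g (k + 1)).enorm).pow_const p)]
  gcongr with x
  rw [fejerMean_add hm hμ hg hh]
  exact (ENNReal.rpow_le_rpow (enorm_add_le _ _) hp0.le).trans
    (ENNReal.rpow_add_le_add_rpow _ _ hp0.le hp1)

lemma energy_zero {p : ℝ} (hp0 : 0 < p) : energy μ p (fun _ : Gm m => (0 : ℂ)) = 0 := by
  simp [energy, fejerMean, coeffFun, hp0]

lemma energy_sum_le (hm : ∀ k, 2 ≤ m k) (hμ : IsHaar m μ) {p : ℝ} (hp0 : 0 < p) (hp1 : p ≤ 1)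
    {ι : Type*} (s : Finset ι) {L : ℕ} {g : ι → Gm m → ℂ} (hg : ∀ i ∈ s, Dep L (g i)) :
    energy μ p (fun y => ∑ i ∈ s, g i y) ≤ ∑ i ∈ s, energy μ p (g i) := by
  classical
  induction s using Finset.induction_on with
  | empty => simp [energy_zero hp0]
  | insert i s hi ih =>
    simp only [sum_insert hi]
    have h1 : ∀ j ∈ s, Dep L (g j) := fun j hj => hg j (mem_insert_of_mem hj)
    refine (energy_add_le hm hμ hp0 hp1 (hg i (mem_insert_self _ _))
      (h := fun y => ∑ j ∈ s, g j y) fun x y hxy => ?_).trans (add_le_add le_rfl (ih h1))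
    exact sum_congr rfl fun j hj => h1 j hj x y hxy

lemma fejerMean_eq_integral (hm : ∀ k, 2 ≤ m k) (hμ : IsHaar m μ) {L : ℕ} {g : Gm m → ℂ}
    (hg : Dep L g) (n : ℕ) (x : Gm m) :
    fejerMean μ g n x = (n : ℂ)⁻¹ * ∫ y, g y * fej m (radSub x y) n ∂μ := by
  have hi := integrable_mul_conj_vil hm hμ hg
  have : ∀ y, g y * fej m (radSub x y) n = ∑ k ∈ range n, ∑ i ∈ range (k + 1),
      g y * (starRingEnd ℂ) (vil m i y) * vil m i x := fun y => by
    simp only [fej, dir, mul_sum, ← vil_mul_conj]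
    exact sum_congr rfl fun k _ => sum_congr rfl fun i _ => by ring
  simp only [this]
  rw [fejerMean, integral_finsetSum _ fun k _ => integrable_finsetSum _
    fun i _ => (hi i).mul_const _]
  congr 1
  refine sum_congr rfl fun k _ => ?_
  rw [integral_finsetSum _ fun i _ => (hi i).mul_const _]
  exact sum_congr rfl fun i _ => by rw [integral_mul_const, coeffFun]

lemma fejerMean_eq_zero (hm : ∀ k, 2 ≤ m k) {N : ℕ} {c : Gm m} {a : Gm m → ℂ}
    (hsupp : ∀ y, y ∉ cylAt m N c → a y = 0) (hmean : ∫ y, a y ∂μ = 0) {n : ℕ}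
    (hn : n < M m N) (x : Gm m) : fejerMean μ a n x = 0 := by
  have : ∀ i, i < M m N → coeffFun μ a i = 0 := fun i hi => by
    have : ∀ y, a y * (starRingEnd ℂ) (vil m i y) = a y * (starRingEnd ℂ) (vil m i c) :=
      fun y => by
        by_cases hy : y ∈ cylAt m N c
        · rw [dep_vil hm hi y c hy]
        · simp [hsupp y hy]
    rw [coeffFun]
    simp only [this]
    rw [integral_mul_const, hmean, zero_mul]
  rw [fejerMean, sum_eq_zero, mul_zero]
  refine fun k hk => sum_eq_zero fun i hi => ?_
  simp only [mem_range] at hk hi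
  rw [this i (by omega), zero_mul]

lemma ofReal_majTerm_le (hm : ∀ k, 2 ≤ m k) (x y : Gm m) (s t : ℕ) :
    ENNReal.ofReal (majTerm m (radSub x y) s t) ≤
      ENNReal.ofReal (M m s * M m t) * (cylOff t s x).indicator 1 y := by
  classical
  rw [majTerm]
  split_ifs with h
  · have : y ∈ cylOff t s x := fun i hi hne => eq_of_radSub_eq_one hm (h i hi hne)
    simp [this]
  · simp

lemma enorm_fejerMean_le (hm : ∀ k, 2 ≤ m k) {lam : ℕ} (hl : ∀ k, m k ≤ lam)
    (hμ : IsHaar m μ) {L N : ℕ} {c : Gm m} {a : Gm m → ℂ} (ha : Dep L a) {A : ℝ}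
    (hA0 : 0 ≤ A) (hA : ∀ y, ‖a y‖ ≤ A) (hsupp : ∀ y, y ∉ cylAt m N c → a y = 0)
    (n : ℕ) (x : Gm m) :
    ‖fejerMean μ a n x‖ₑ ≤ ENNReal.ofReal (A * (3 * lam ^ 3) * (n : ℝ)⁻¹) *
      ∑ s ∈ range n with M m s ≤ n, ∑ t ∈ range (s + 1),
        ENNReal.ofReal (M m s * M m t) * μ (cylAt m N c ∩ cylOff t s x) := by
  have hn' : ‖((n : ℂ)⁻¹)‖ₑ = ENNReal.ofReal (n : ℝ)⁻¹ := by
    rw [← ofReal_norm, norm_inv, Complex.norm_natCast]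
  rw [fejerMean_eq_integral hm hμ ha, enorm_mul, hn', mul_comm (A * _),
    ENNReal.ofReal_mul (by positivity), mul_assoc]
  gcongr
  refine (enorm_integral_le_lintegral_enorm _).trans ?_
  have hpt : ∀ y, ‖a y * fej m (radSub x y) n‖ₑ ≤ ENNReal.ofReal (A * (3 * lam ^ 3)) *
      ∑ s ∈ range n with M m s ≤ n, ∑ t ∈ range (s + 1),
        ENNReal.ofReal (M m s * M m t) * (cylAt m N c ∩ cylOff t s x).indicator 1 y := fun y => by
    by_cases hy : y ∈ cylAt m N c
    · have h1 := norm_fej_le_sum_ite hm hl (radSub_pow hm x y) (norm_radSub hm x y) n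
      have h2 : ‖a y * fej m (radSub x y) n‖ ≤ A * (3 * lam ^ 3) *
          ∑ s ∈ range n with M m s ≤ n, ∑ t ∈ range (s + 1), majTerm m (radSub x y) s t := by
        rw [norm_mul, mul_assoc A]
        exact mul_le_mul (hA y) h1 (norm_nonneg _) hA0
      rw [← ofReal_norm]
      refine (ENNReal.ofReal_le_ofReal h2).trans ?_
      rw [ENNReal.ofReal_mul (by positivity), ENNReal.ofReal_sum_of_nonneg fun s _ =>
        sum_nonneg fun t _ => majTerm_nonneg _ s t]
      gcongr with s hs
      rw [ENNReal.ofReal_sum_of_nonneg fun t _ => majTerm_nonneg _ s t]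
      gcongr with t ht
      refine (ofReal_majTerm_le hm x y s t).trans_eq ?_
      by_cases hy' : y ∈ cylOff t s x
      · rw [Set.indicator_of_mem hy', Set.indicator_of_mem (Set.mem_inter hy hy')]
      · rw [Set.indicator_of_notMem hy', Set.indicator_of_notMem fun h => hy' h.2]
    · simp [hsupp y hy]
  refine (lintegral_mono hpt).trans_eq ?_
  have hmeas : ∀ s t, Measurable fun y => ENNReal.ofReal (M m s * M m t) *
      (cylAt m N c ∩ cylOff t s x).indicator (1 : Gm m → ℝ≥0∞) y := fun s t =>
    (measurable_one.indicator ((measurableSet_cylAt N c).inter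
      (measurableSet_cylOff hm t s x))).const_mul _
  rw [lintegral_const_mul _ (Finset.measurable_sum _ fun s _ => Finset.measurable_sum _
    fun t _ => hmeas s t), lintegral_finsetSum _ fun s _ => Finset.measurable_sum _
    fun t _ => hmeas s t]
  congr 1
  refine sum_congr rfl fun s _ => ?_
  rw [lintegral_finsetSum _ fun t _ => hmeas s t]
  refine sum_congr rfl fun t _ => ?_
  have hms := (measurableSet_cylAt N c).inter (measurableSet_cylOff hm t s x)
  rw [lintegral_const_mul _ (measurable_one.indicator hms), lintegral_indicator_one hms]

lemma ofReal_div_M (hm : ∀ k, 2 ≤ m k) (lam s : ℕ) :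
    (lam : ℝ≥0∞) * (M m s : ℝ≥0∞)⁻¹ = ENNReal.ofReal (lam / M m s) := by
  rw [div_eq_mul_inv, ENNReal.ofReal_mul (by positivity), ENNReal.ofReal_inv_of_pos
    (by exact_mod_cast M_pos hm s), ENNReal.ofReal_natCast, ENNReal.ofReal_natCast]

lemma measure_inter_cylOff_le (hm : ∀ k, 2 ≤ m k) {lam : ℕ} (hl : ∀ k, m k ≤ lam)
    (hμ : IsHaar m μ) (N s t : ℕ) (c x : Gm m) :
    μ (cylAt m N c ∩ cylOff t s x) ≤
      ENNReal.ofReal (lam / max (M m s : ℝ) (M m N)) *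
        (cylOff t (min s N) c).indicator 1 x := by
  by_cases hx : x ∈ cylOff t (min s N) c
  · simp only [hx, Set.indicator_of_mem, Pi.one_apply, mul_one]
    have h1 : μ (cylAt m N c ∩ cylOff t s x) ≤ ENNReal.ofReal (lam / M m s) := by
      rw [← ofReal_div_M hm]
      exact (measure_mono Set.inter_subset_right).trans (measure_cylOff_le hm hl hμ t s x)
    have h2 : μ (cylAt m N c ∩ cylOff t s x) ≤ ENNReal.ofReal (lam / M m N) := by
      rw [← ofReal_div_M hm]
      refine (measure_mono Set.inter_subset_left).trans ?_
      rw [hμ N c]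
      refine le_mul_of_one_le_left zero_le ?_
      exact_mod_cast (by have := hm 0; have := hl 0; omega : 1 ≤ lam)
    rcases le_total (M m s : ℝ) (M m N) with h | h
    · rwa [max_eq_right h]
    · rwa [max_eq_left h]
  · have : cylAt m N c ∩ cylOff t s x = ∅ := by
      ext y
      simp only [Set.mem_inter_iff, Set.mem_empty_iff_false, iff_false, not_and]
      refine fun hy hy' => hx fun i hi hne => ?_
      rw [hy' i (hi.trans_le (min_le_left _ _)) hne, hy i (hi.trans_le (min_le_right _ _))]
    simp [this]

lemma lintegral_fejerMean_le (hm : ∀ k, 2 ≤ m k) {lam : ℕ} (hl : ∀ k, m k ≤ lam)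
    (hμ : IsHaar m μ) {p : ℝ} (hp0 : 0 < p) (hp1 : p ≤ 1) {L N : ℕ} {c : Gm m}
    {a : Gm m → ℂ} (ha : Dep L a) {A : ℝ} (hA0 : 0 ≤ A) (hA : ∀ y, ‖a y‖ ≤ A)
    (hsupp : ∀ y, y ∉ cylAt m N c → a y = 0) (hmean : N ≠ 0 → ∫ y, a y ∂μ = 0)
    {n : ℕ} (hn : n ≠ 0) :
    ∫⁻ x, ‖fejerMean μ a n x‖ₑ ^ p ∂μ ≤
      ENNReal.ofReal ((A * (3 * lam ^ 3)) ^ p * (n : ℝ) ^ (-p)) *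
        ∑' s, ∑ t ∈ range (s + 1), if max (M m s) (M m N) ≤ n then
          ENNReal.ofReal ((M m s * M m t * (lam / max (M m s : ℝ) (M m N))) ^ p *
            (lam / min (M m s : ℝ) (M m N))) else 0 := by
  rcases lt_or_ge n (M m N) with hnN | hnN
  · have hN : N ≠ 0 := by rintro rfl; simp [M] at hnN; exact hn hnN
    simp [fejerMean_eq_zero hm hsupp (hmean hN) hnN, hp0]
  have hpt : ∀ x, ‖fejerMean μ a n x‖ₑ ^ p ≤
      ENNReal.ofReal ((A * (3 * lam ^ 3)) ^ p * (n : ℝ) ^ (-p)) *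
        ∑ s ∈ range n with M m s ≤ n, ∑ t ∈ range (s + 1),
          ENNReal.ofReal ((M m s * M m t * (lam / max (M m s : ℝ) (M m N))) ^ p) *
            (cylOff t (min s N) c).indicator 1 x := fun x => by
    refine (ENNReal.rpow_le_rpow (enorm_fejerMean_le hm hl hμ ha hA0 hA hsupp n x)
      hp0.le).trans ?_
    rw [ENNReal.mul_rpow_of_nonneg _ _ hp0.le, ENNReal.ofReal_rpow_of_nonneg (by positivity) hp0.le,
      Real.mul_rpow (by positivity) (by positivity), Real.inv_rpow (by positivity),
      ← Real.rpow_neg (by positivity)]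
    refine mul_le_mul_right ?_ _
    refine (ennreal_rpow_sum_le _ _ hp0 hp1).trans (sum_le_sum fun s _ => ?_)
    refine (ennreal_rpow_sum_le _ _ hp0 hp1).trans (sum_le_sum fun t _ => ?_)
    refine (ENNReal.rpow_le_rpow (mul_le_mul_right (measure_inter_cylOff_le hm hl hμ N s t c x)
      _) hp0.le).trans_eq ?_
    rw [← mul_assoc, ← ENNReal.ofReal_mul (by positivity), ENNReal.mul_rpow_of_nonneg _ _ hp0.le,
      ENNReal.ofReal_rpow_of_nonneg (by positivity) hp0.le]
    by_cases hx : x ∈ cylOff t (min s N) c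
    · simp [hx]
    · simp [hx, hp0]
  refine (lintegral_mono hpt).trans ?_
  have hind : ∀ s t, Measurable ((cylOff t (min s N) c).indicator (1 : Gm m → ℝ≥0∞)) :=
    fun s t => measurable_one.indicator (measurableSet_cylOff hm t _ c)
  have hmeas : ∀ s t, Measurable fun x =>
      ENNReal.ofReal ((M m s * M m t * (lam / max (M m s : ℝ) (M m N))) ^ p) *
        (cylOff t (min s N) c).indicator (1 : Gm m → ℝ≥0∞) x := fun s t => (hind s t).const_mul _
  rw [lintegral_const_mul _ (Finset.measurable_sum _ fun s _ => Finset.measurable_sum _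
    fun t _ => hmeas s t), lintegral_finsetSum _ fun s _ => Finset.measurable_sum _
    fun t _ => hmeas s t]
  gcongr
  refine le_trans (sum_le_sum fun s hs => ?_) (ENNReal.sum_le_tsum (range n |>.filter
    fun s => M m s ≤ n))
  rw [lintegral_finsetSum _ fun t _ => hmeas s t]
  gcongr with t ht
  rw [if_pos (max_le (mem_filter.1 hs).2 hnN), lintegral_const_mul _ (hind s t),
    lintegral_indicator_one (measurableSet_cylOff hm t _ c), ENNReal.ofReal_mul (by positivity)]
  gcongr
  refine (measure_cylOff_le hm hl hμ t _ c).trans_eq ?_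
  rw [ofReal_div_M hm, (M_mono hm).map_min, Nat.cast_min]

/-- The constant in the estimate for atoms. -/
def atomConst (p : ℝ) (lam : ℕ) : ℝ≥0∞ :=
  ENNReal.ofReal ((3 * lam ^ 3) ^ p * (5 * (lam ^ p * lam))) *
    ∑' s : ℕ, ENNReal.ofReal ((s + 1) * ((2 : ℝ) ^ (2 * p - 1)) ^ s)

lemma atomConst_ne_top {p : ℝ} (hp1 : p < 1 / 2) (lam : ℕ) : atomConst p lam ≠ ⊤ := by
  refine ENNReal.mul_ne_top ENNReal.ofReal_ne_top (Summable.tsum_ofReal_ne_top ?_)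
  have h0 : (0 : ℝ) < 2 ^ (2 * p - 1) := by positivity
  have h1 : (2 : ℝ) ^ (2 * p - 1) < 1 := Real.rpow_lt_one_of_one_lt_of_neg (by norm_num) (by linarith)
  have h2 : ‖(2 : ℝ) ^ (2 * p - 1)‖ < 1 := by rwa [Real.norm_of_nonneg h0.le]
  have := (summable_pow_mul_geometric_of_norm_lt_one 1 h2).add
    (summable_geometric_of_norm_lt_one h2)
  simpa [add_mul] using this

/-- The estimate for atoms. -/
lemma energy_atom_le (hm : ∀ k, 2 ≤ m k) {lam : ℕ} (hl : ∀ k, m k ≤ lam)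
    (hμ : IsHaar m μ) {p : ℝ} (hp0 : 0 < p) (hp1 : p < 1 / 2) {L N : ℕ} {c : Gm m}
    {a : Gm m → ℂ} (ha : Dep L a) {A : ℝ} (hA0 : 0 ≤ A) (hA : ∀ y, ‖a y‖ ≤ A)
    (hsupp : ∀ y, y ∉ cylAt m N c → a y = 0) (hmean : N ≠ 0 → ∫ y, a y ∂μ = 0) :
    energy μ p a ≤ atomConst p lam * ENNReal.ofReal (A ^ p) * (M m N : ℝ≥0∞)⁻¹ := by
  set K := (A * (3 * lam ^ 3)) ^ p with hK
  have hK0 : 0 ≤ K := by positivity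
  set q : ℕ → ℕ → ℝ := fun s t => (M m s * M m t * (lam / max (M m s : ℝ) (M m N))) ^ p *
    (lam / min (M m s : ℝ) (M m N)) with hq
  have hq0 : ∀ s t, 0 ≤ q s t := fun s t => by positivity
  have hterm : ∀ k : ℕ, (∫⁻ x, ‖fejerMean μ a (k + 1) x‖ₑ ^ p ∂μ) /
      ((k + 1 : ℕ) : ℝ≥0∞) ^ (2 - 2 * p) ≤ ENNReal.ofReal K * ∑' s, ∑ t ∈ range (s + 1),
        ENNReal.ofReal (q s t) * (if max (M m s) (M m N) ≤ k + 1 then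
          ENNReal.ofReal (((k + 1 : ℕ) : ℝ) ^ (p - 2)) else 0) := fun k => by
    have hk : (0 : ℝ) < ((k + 1 : ℕ) : ℝ) := by positivity
    have hw : (((k + 1 : ℕ) : ℝ≥0∞) ^ (2 - 2 * p))⁻¹ =
        ENNReal.ofReal (((k + 1 : ℕ) : ℝ) ^ (-(2 - 2 * p))) := by
      rw [← ENNReal.rpow_neg, ← ENNReal.ofReal_natCast, ENNReal.ofReal_rpow_of_pos hk]
    rw [ENNReal.div_eq_inv_mul, hw]
    refine (mul_le_mul_right (lintegral_fejerMean_le hm hl hμ hp0 (by linarith) ha hA0 hA hsupp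
      hmean k.succ_ne_zero) _).trans_eq ?_
    rw [← mul_assoc, ← ENNReal.ofReal_mul (by positivity), mul_left_comm, ← Real.rpow_add hk,
      ENNReal.ofReal_mul hK0, mul_assoc, ← ENNReal.tsum_mul_left]
    congr 2
    funext s
    rw [mul_sum]
    refine sum_congr rfl fun t _ => ?_
    split_ifs
    · rw [mul_comm]; congr 3; ring
    · simp
  have hsum : ∀ s, ∑' k : ℕ, ∑ t ∈ range (s + 1),
        ENNReal.ofReal (q s t) * (if max (M m s) (M m N) ≤ k + 1 then
          ENNReal.ofReal (((k + 1 : ℕ) : ℝ) ^ (p - 2)) else 0) ≤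
      ENNReal.ofReal (5 * (lam ^ p * lam) / M m N) *
        ENNReal.ofReal ((s + 1) * ((2 : ℝ) ^ (2 * p - 1)) ^ s) := fun s => by
    rw [Summable.tsum_finsetSum fun _ _ => ENNReal.summable]
    have hterm' : ∀ t ∈ range (s + 1), ∑' k : ℕ, ENNReal.ofReal (q s t) *
        (if max (M m s) (M m N) ≤ k + 1 then
          ENNReal.ofReal (((k + 1 : ℕ) : ℝ) ^ (p - 2)) else 0) ≤
        ENNReal.ofReal (5 * (lam ^ p * lam) / M m N * ((2 : ℝ) ^ (2 * p - 1)) ^ s) :=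
      fun t ht => by
        have hX : 1 ≤ max (M m s) (M m N) := le_max_of_le_left (M_pos hm s)
        have hMs : (0 : ℝ) < M m s := by exact_mod_cast M_pos hm s
        have hMN : (0 : ℝ) < M m N := by exact_mod_cast M_pos hm N
        rw [ENNReal.tsum_mul_left]
        refine (mul_le_mul_right (tsum_rpow_tail_le hp1 hX) _).trans ?_
        rw [← ENNReal.ofReal_mul (hq0 s t)]
        refine ENNReal.ofReal_le_ofReal ?_
        have h1 := term_le hp0 (a := M m s) (b := M m t) (w := M m N) (l := lam)
          (by exact_mod_cast M_pos hm t)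
          (by exact_mod_cast M_mono hm (Nat.lt_succ_iff.1 (mem_range.1 ht))) hMN (by positivity)
        have h2 : (M m s : ℝ) ^ (2 * p - 1) ≤ ((2 : ℝ) ^ (2 * p - 1)) ^ s := by
          rw [Real.rpow_pow_comm (by norm_num)]
          exact Real.rpow_le_rpow_of_nonpos (by positivity)
            (by exact_mod_cast two_pow_le_M hm s) (by linarith)
        rw [Nat.cast_max]
        calc q s t * (5 * max (M m s : ℝ) (M m N) ^ (p - 1))
            = 5 * (q s t * max (M m s : ℝ) (M m N) ^ (p - 1)) := by ring
          _ ≤ 5 * ((lam : ℝ) ^ p * lam / M m N * ((2 : ℝ) ^ (2 * p - 1)) ^ s) := by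
            refine mul_le_mul_of_nonneg_left (h1.trans ?_) (by norm_num)
            gcongr
          _ = _ := by ring
    refine (sum_le_sum hterm').trans_eq ?_
    rw [sum_const, card_range, nsmul_eq_mul, ← ENNReal.ofReal_natCast,
      ← ENNReal.ofReal_mul (by positivity), ← ENNReal.ofReal_mul (by positivity)]
    push_cast
    congr 1
    ring
  calc energy μ p a ≤ ∑' k : ℕ, ENNReal.ofReal K * ∑' s, ∑ t ∈ range (s + 1),
        ENNReal.ofReal (q s t) * (if max (M m s) (M m N) ≤ k + 1 then
          ENNReal.ofReal (((k + 1 : ℕ) : ℝ) ^ (p - 2)) else 0) := ENNReal.tsum_le_tsum hterm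
    _ = ENNReal.ofReal K * ∑' s, ∑' k : ℕ, ∑ t ∈ range (s + 1),
        ENNReal.ofReal (q s t) * (if max (M m s) (M m N) ≤ k + 1 then
          ENNReal.ofReal (((k + 1 : ℕ) : ℝ) ^ (p - 2)) else 0) := by
      rw [ENNReal.tsum_mul_left, ENNReal.tsum_comm]
    _ ≤ ENNReal.ofReal K * ∑' s : ℕ, (ENNReal.ofReal (5 * (lam ^ p * lam) / M m N) *
        ENNReal.ofReal ((s + 1) * ((2 : ℝ) ^ (2 * p - 1)) ^ s)) := by
      gcongr with s
      exact hsum s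
    _ = _ := by
      have hMN : (0 : ℝ) < M m N := by exact_mod_cast M_pos hm N
      have e : (M m N : ℝ≥0∞)⁻¹ = ENNReal.ofReal (M m N : ℝ)⁻¹ := by
        rw [ENNReal.ofReal_inv_of_pos hMN, ENNReal.ofReal_natCast]
      have e2 : ENNReal.ofReal K * ENNReal.ofReal (5 * (lam ^ p * lam) / M m N) =
          ENNReal.ofReal ((3 * lam ^ 3) ^ p * (5 * (lam ^ p * lam))) * ENNReal.ofReal (A ^ p) *
            ENNReal.ofReal (M m N : ℝ)⁻¹ := by
        rw [← ENNReal.ofReal_mul hK0, ← ENNReal.ofReal_mul (by positivity),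
          ← ENNReal.ofReal_mul (by positivity)]
        congr 1
        rw [hK, Real.mul_rpow hA0 (by positivity)]
        ring
      rw [ENNReal.tsum_mul_left, atomConst, ← mul_assoc, e2, e]
      ring

end Energy

end Vilenkin

namespace Vilenkin

section Stopping

open Classical in
/-- The sum of `v` over the indices satisfying a predicate that determines its index. -/
lemma sum_ite_of_unique {β : Type*} [AddCommMonoid β] {P : ℕ → Prop}
    (hP : ∀ i j, P i → P j → i = j) {s : Finset ℕ} {i : ℕ} (his : i ∈ s) (hi : P i) (v : β) :
    ∑ j ∈ s, (if P j then v else 0) = v := by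
  rw [sum_eq_single_of_mem i his fun j _ hj => if_neg fun h => hj (hP j i h hi), if_pos hi]

variable {m : ℕ → ℕ} {f : ℕ → Gm m → ℂ} {A A' : ℝ} {L n N : ℕ} {x c : Gm m}

variable (f) in
/-- The value of `f (n + 1)` exceeds `A` somewhere on the `n`-cylinder of `x`. -/
def StopAt (A : ℝ) (n : ℕ) (x : Gm m) : Prop :=
  (n = 0 ∧ A < ‖f 0 x‖) ∨ ∃ y ∈ cylAt m n x, A < ‖f (n + 1) y‖

variable (f) in
/-- No stopping up to time `n`. -/
def Alive (A : ℝ) (n : ℕ) (x : Gm m) : Prop := ∀ k ≤ n, ¬ StopAt f A k x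

variable (f) in
/-- The first stopping happens at time `n`. -/
def FirstStop (A : ℝ) (n : ℕ) (x : Gm m) : Prop := StopAt f A n x ∧ ∀ k < n, ¬ StopAt f A k x

open Classical in
variable (f) in
/-- The martingale stopped just before its norm exceeds `A`, at time `L`. -/
def stopped (A : ℝ) (L : ℕ) (x : Gm m) : ℂ :=
  (if ‖f 0 x‖ ≤ A then f 0 x else 0) +
    ∑ n ∈ range L, if Alive f A n x then f (n + 1) x - f n x else 0

lemma StopAt.anti (hA : A ≤ A') (h : StopAt f A' n x) : StopAt f A n x :=
  h.imp (fun h => ⟨h.1, hA.trans_lt h.2⟩) fun ⟨y, hy, h⟩ => ⟨y, hy, hA.trans_lt h⟩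

lemma Alive.mono (hA : A ≤ A') (h : Alive f A n x) : Alive f A' n x :=
  fun k hk hs => h k hk (hs.anti hA)

lemma Alive.norm_le (h : Alive f A n x) : ‖f (n + 1) x‖ ≤ A :=
  not_lt.1 fun hlt => h n le_rfl (Or.inr ⟨x, fun _ _ => rfl, hlt⟩)

lemma norm_zero_le_of_not_stopAt (h : ¬ StopAt f A 0 x) : ‖f 0 x‖ ≤ A :=
  not_lt.1 fun hlt => h (Or.inl ⟨rfl, hlt⟩)

lemma FirstStop.unique (i j : ℕ) (hi : FirstStop f A i x) (hj : FirstStop f A j x) : i = j := by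
  rcases lt_trichotomy i j with h | h | h
  · exact (hj.2 i h hi.1).elim
  · exact h
  · exact (hi.2 j h hj.1).elim

lemma exists_firstStop (h : ¬ Alive f A L x) : ∃ N ∈ range (L + 1), FirstStop f A N x := by
  classical
  have h' : ∃ k, k ≤ L ∧ StopAt f A k x := by simpa [Alive] using h
  refine ⟨Nat.find h', mem_range.2 (Nat.lt_succ_of_le (Nat.find_spec h').1),
    (Nat.find_spec h').2, fun k hk hs => ?_⟩
  exact Nat.find_min h' hk ⟨hk.le.trans (Nat.find_spec h').1, hs⟩

lemma dep_stopAt (h0 : Dep 0 (f 0)) (A : ℝ) (n : ℕ) : Dep n (StopAt f A n) := fun x y hxy => by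
  have h1 : cylAt m n x = cylAt m n y := by
    ext z
    exact forall₂_congr fun k hk => by rw [hxy k hk]
  have h2 : f 0 x = f 0 y := h0 x y fun k hk => by omega
  simp only [StopAt, h1, h2]

lemma dep_alive (h0 : Dep 0 (f 0)) (A : ℝ) (n : ℕ) : Dep n (Alive f A n) := fun x y hxy => by
  simp only [Alive, eq_iff_iff]
  exact forall₂_congr fun k hk => by
    rw [dep_stopAt h0 A k x y fun i hi => hxy i (hi.trans_le hk)]

lemma dep_firstStop (h0 : Dep 0 (f 0)) (A : ℝ) (n : ℕ) : Dep n (FirstStop f A n) :=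
  fun x y hxy => by
    simp only [FirstStop, eq_iff_iff]
    rw [dep_stopAt h0 A n x y hxy]
    refine and_congr_right fun _ => forall₂_congr fun k hk => ?_
    rw [dep_stopAt h0 A k x y fun i hi => hxy i (hi.trans hk)]

lemma dep_stopped (hf : ∀ n, Dep n (f n)) (A : ℝ) (L : ℕ) : Dep L (stopped f A L) :=
  fun x y hxy => by
    have h0 : f 0 x = f 0 y := hf 0 x y fun k hk => by omega
    simp only [stopped, h0]
    congr 1
    refine sum_congr rfl fun n hn => ?_
    have hn := mem_range.1 hn
    rw [dep_alive (hf 0) A n x y fun i hi => hxy i (hi.trans hn),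
      hf n x y fun i hi => hxy i (hi.trans hn),
      hf (n + 1) x y fun i hi => hxy i (hi.trans_le hn)]

open Classical in
lemma norm_stopped_le_and (hA : 0 ≤ A) (L : ℕ) (x : Gm m) :
    ‖stopped f A L x‖ ≤ A ∧ (Alive f A L x → stopped f A L x = f L x) := by
  induction L with
  | zero =>
    simp only [stopped, range_zero, sum_empty, add_zero]
    split_ifs with h
    · exact ⟨h, fun _ => rfl⟩
    · exact ⟨by simpa using hA, fun ha => (h (norm_zero_le_of_not_stopAt (ha 0 le_rfl))).elim⟩
  | succ L ih =>
    have hs : stopped f A (L + 1) x = stopped f A L x +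
        if Alive f A L x then f (L + 1) x - f L x else 0 := by
      simp only [stopped, sum_range_succ, add_assoc]
    by_cases h : Alive f A L x
    · rw [hs, if_pos h, ih.2 h, add_sub_cancel]
      exact ⟨h.norm_le, fun _ => rfl⟩
    · rw [hs, if_neg h, add_zero]
      exact ⟨ih.1, fun ha => (h fun k hk => ha k (hk.trans L.le_succ)).elim⟩

lemma norm_stopped_le (hA : 0 ≤ A) (L : ℕ) (x : Gm m) : ‖stopped f A L x‖ ≤ A :=
  (norm_stopped_le_and hA L x).1

lemma stopped_eq (hA : ∀ n ≤ L + 1, ∀ y, ‖f n y‖ ≤ A) (x : Gm m) : stopped f A L x = f L x := by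
  have hA0 : 0 ≤ A := (norm_nonneg _).trans (hA 0 (Nat.zero_le _) x)
  refine (norm_stopped_le_and hA0 L x).2 fun k hk hs => ?_
  rcases hs with ⟨_, h⟩ | ⟨y, _, h⟩
  · exact (hA 0 (Nat.zero_le _) x).not_gt h
  · exact (hA (k + 1) (by omega) y).not_gt h

/-- The difference of two stopped martingales, as long as neither has been stopped. -/
lemma stopped_sub_eq_zero (hA : A ≤ A') (hA0 : 0 ≤ A) (h : Alive f A L x) :
    stopped f A' L x - stopped f A L x = 0 := by
  rw [(norm_stopped_le_and hA0 L x).2 h,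
    (norm_stopped_le_and (hA0.trans hA) L x).2 (h.mono hA), sub_self]

open Classical in
variable (f) in
/-- The part of the difference of two stopped martingales living on a cylinder on which the
lower level stops first. -/
def piece (A A' : ℝ) (L N : ℕ) (c x : Gm m) : ℂ :=
  if FirstStop f A N c ∧ x ∈ cylAt m N c then stopped f A' L x - stopped f A L x else 0

open Classical in
lemma sum_firstStop {β : Type*} [AddCommMonoid β] (hm : ∀ k, 2 ≤ m k) (h0 : Dep 0 (f 0)) (A : ℝ)
    (N : ℕ) (x : Gm m) (v : β) :
    ∑ c ∈ reps hm N, (if FirstStop f A N c ∧ x ∈ cylAt m N c then v else 0) =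
      if FirstStop f A N x then v else 0 := by
  have := sum_reps hm N (fun c => if FirstStop f A N c then v else 0) x
  rw [(dep_firstStop h0 A N).trunc_eq] at this
  rw [← this]
  refine sum_congr rfl fun c _ => ?_
  rw [← ite_and]
  exact if_congr and_comm rfl rfl

lemma stopped_sub_eq_sum (hm : ∀ k, 2 ≤ m k) (h0 : Dep 0 (f 0)) (hA : A ≤ A') (hA0 : 0 ≤ A)
    (x : Gm m) : stopped f A' L x - stopped f A L x =
      ∑ N ∈ range (L + 1), ∑ c ∈ reps hm N, piece f A A' L N c x := by
  classical
  simp only [piece, sum_firstStop hm h0]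
  by_cases h : Alive f A L x
  · simp [stopped_sub_eq_zero hA hA0 h]
  · obtain ⟨N, hN, hs⟩ := exists_firstStop h
    exact (sum_ite_of_unique FirstStop.unique hN hs _).symm

lemma dep_piece (hf : ∀ n, Dep n (f n)) (A A' : ℝ) (c : Gm m) (hN : N ≤ L) :
    Dep L (piece f A A' L N c) := fun x y hxy => by
  have h : (x ∈ cylAt m N c) = (y ∈ cylAt m N c) := (dep_mem_cylAt N c).mono hN x y hxy
  rw [piece, piece, dep_stopped hf A L x y hxy, dep_stopped hf A' L x y hxy, h]

lemma norm_piece_le (hA : A ≤ A') (hA0 : 0 ≤ A) (c x : Gm m) :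
    ‖piece f A A' L N c x‖ ≤ A' + A := by
  rw [piece]
  split_ifs
  · exact (norm_sub_le _ _).trans (add_le_add (norm_stopped_le (hA0.trans hA) L x)
      (norm_stopped_le hA0 L x))
  · rw [norm_zero]
    linarith

open Classical in
lemma piece_eq_sum (h0 : Dep 0 (f 0)) (hA : A ≤ A') (hN : N ≠ 0) (c x : Gm m) :
    piece f A A' L N c x = ∑ n ∈ range L, (f (n + 1) x - f n x) *
      if N ≤ n ∧ Alive f A' n x ∧ FirstStop f A N c ∧ x ∈ cylAt m N c then 1 else 0 := by
  rw [piece]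
  split_ifs with h
  · have hs : FirstStop f A N x := by rw [dep_firstStop h0 A N x c h.2]; exact h.1
    have h1 : ‖f 0 x‖ ≤ A := norm_zero_le_of_not_stopAt (hs.2 0 (Nat.pos_of_ne_zero hN))
    rw [stopped, stopped, if_pos h1, if_pos (h1.trans hA), add_sub_add_left_eq_sub,
      ← sum_sub_distrib]
    refine sum_congr rfl fun n _ => ?_
    by_cases hn : N ≤ n
    · have : ¬ Alive f A n x := fun ha => ha N hn hs.1
      simp [this, hn, h]
    · have ha : Alive f A n x := fun k hk => hs.2 k (by omega)
      simp [ha, ha.mono hA, hn]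
  · simp [h]

variable {μ : Measure (Gm m)}

lemma integral_piece (hm : ∀ k, 2 ≤ m k) (hμ : IsHaar m μ) (hf : IsMartingale m μ f)
    (hA : A ≤ A') (hN : N ≠ 0) (c : Gm m) : ∫ x, piece f A A' L N c x ∂μ = 0 := by
  classical
  have hdep : ∀ n, Dep n fun x : Gm m => if N ≤ n ∧ Alive f A' n x ∧ FirstStop f A N c ∧
      x ∈ cylAt m N c then (1 : ℂ) else 0 := fun n x y hxy => by
    by_cases hn : N ≤ n
    · simp only [dep_alive (hf.dep 0) A' n x y hxy, (dep_mem_cylAt N c).mono hn x y hxy]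
    · simp [hn]
  have hi : ∀ n k, n ≤ k → Integrable (fun x => f k x * if N ≤ n ∧ Alive f A' n x ∧
      FirstStop f A N c ∧ x ∈ cylAt m N c then (1 : ℂ) else 0) μ := fun n k hk =>
    ((hf.dep k).comp₂ ((hdep n).mono hk) (· * ·)).integrable hm hμ
  simp only [piece_eq_sum (hf.dep 0) hA hN, sub_mul]
  refine (integral_finsetSum _ fun n _ => (hi n (n + 1) n.le_succ).sub (hi n n le_rfl)).trans
    (sum_eq_zero fun n _ => ?_)
  refine (integral_sub (hi n (n + 1) n.le_succ) (hi n n le_rfl)).trans ?_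
  rw [hf.integral_mul hm hμ n.le_succ (hdep n),
    sub_self]

variable (f) in
/-- The level set of the maximal function. -/
def levelSet (A : ℝ) : Set (Gm m) := {x | ENNReal.ofReal A < mstar m f x}

lemma mem_levelSet {n : ℕ} (hA : 0 ≤ A) (h : A < ‖f n x‖) : x ∈ levelSet f A := by
  refine lt_of_lt_of_le ?_ (le_iSup (fun n => (‖f n x‖₊ : ℝ≥0∞)) n)
  change _ < ‖f n x‖ₑ
  rw [← ofReal_norm]
  exact (ENNReal.ofReal_lt_ofReal_iff (hA.trans_lt h)).2 h

lemma measurable_mstar (hm : ∀ k, 2 ≤ m k) (hf : ∀ n, Dep n (f n)) : Measurable (mstar m f) :=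
  Measurable.iSup fun n => ((hf n).measurable hm).enorm

lemma measurableSet_levelSet (hm : ∀ k, 2 ≤ m k) (hf : ∀ n, Dep n (f n)) (A : ℝ) :
    MeasurableSet (levelSet f A) :=
  measurableSet_lt measurable_const (measurable_mstar hm hf)

lemma FirstStop.inv_M_le (hm : ∀ k, 2 ≤ m k) {lam : ℕ} (hl : ∀ k, m k ≤ lam) (hμ : IsHaar m μ)
    (hf : ∀ n, Dep n (f n)) (hA : 0 ≤ A) (h : FirstStop f A N c) :
    (M m N : ℝ≥0∞)⁻¹ ≤ lam * μ (cylAt m N c ∩ levelSet f A) := by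
  have hlam : (1 : ℝ≥0∞) ≤ lam := by
    exact_mod_cast (by have := hm 0; have := hl 0; omega : 1 ≤ lam)
  rcases h.1 with ⟨rfl, h0⟩ | ⟨y, hy, hlt⟩
  · have : cylAt m 0 c ⊆ cylAt m 0 c ∩ levelSet f A := fun x hx => ⟨hx, mem_levelSet hA
      (by rwa [hf 0 x c hx] : A < ‖f 0 x‖)⟩
    rw [← hμ 0 c]
    exact (measure_mono this).trans (le_mul_of_one_le_left zero_le hlam)
  · have : cylAt m (N + 1) y ⊆ cylAt m N c ∩ levelSet f A := fun x hx =>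
      ⟨fun k hk => (hx k (by omega)).trans (hy k hk), mem_levelSet hA
        (by rwa [hf (N + 1) x y hx] : A < ‖f (N + 1) x‖)⟩
    refine le_trans ?_ (mul_le_mul_right (measure_mono this) _)
    have hm0 : (m N : ℝ≥0∞) ≠ 0 := by exact_mod_cast (by have := hm N; omega : m N ≠ 0)
    rw [hμ, M, Nat.cast_mul, ENNReal.mul_inv (Or.inl hm0) (Or.inl (ENNReal.natCast_ne_top _)),
      ← mul_assoc]
    refine le_mul_of_one_le_left zero_le ?_
    rw [← ENNReal.mul_inv_cancel hm0 (ENNReal.natCast_ne_top _)]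
    gcongr
    exact hl N

open Classical in
lemma sum_measure_firstStop_le (hm : ∀ k, 2 ≤ m k) (hf : ∀ n, Dep n (f n)) {E : Set (Gm m)}
    (hE : MeasurableSet E) (A : ℝ) (L : ℕ) :
    ∑ N ∈ range L, ∑ c ∈ reps hm N, (if FirstStop f A N c then μ (cylAt m N c ∩ E) else 0) ≤
      μ E := by
  have h1 : ∀ N c, (if FirstStop f A N c then μ (cylAt m N c ∩ E) else 0) =
      ∫⁻ x, (if FirstStop f A N c ∧ x ∈ cylAt m N c then E.indicator 1 x else 0) ∂μ :=
    fun N c => by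
      by_cases h : FirstStop f A N c
      · simp only [h, true_and, if_true]
        rw [← lintegral_indicator_one ((measurableSet_cylAt N c).inter hE)]
        refine lintegral_congr fun x => ?_
        by_cases hx : x ∈ cylAt m N c <;> simp [Set.indicator_apply, hx]
      · simp [h]
  have hmeas : ∀ N c, Measurable fun x => if FirstStop f A N c ∧ x ∈ cylAt m N c then
      E.indicator (1 : Gm m → ℝ≥0∞) x else 0 := fun N c => by
    by_cases h : FirstStop f A N c
    · simp only [h, true_and]
      exact Measurable.ite (measurableSet_cylAt N c) (measurable_one.indicator hE)
        measurable_const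
    · simp [h]
  simp only [h1]
  rw [← lintegral_indicator_one hE]
  calc _ = ∫⁻ x, ∑ N ∈ range L, ∑ c ∈ reps hm N, (if FirstStop f A N c ∧ x ∈ cylAt m N c then
        E.indicator 1 x else 0) ∂μ := by
        rw [lintegral_finsetSum _ fun N _ => Finset.measurable_sum _ fun c _ => hmeas N c]
        exact sum_congr rfl fun N _ => (lintegral_finsetSum _ fun c _ => hmeas N c).symm
    _ ≤ _ := by
        refine lintegral_mono fun x => ?_
        simp only [sum_firstStop hm (hf 0)]
        by_cases h : ∃ N ∈ range L, FirstStop f A N x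
        · obtain ⟨N, hN, hs⟩ := h
          exact (sum_ite_of_unique FirstStop.unique hN hs _).le
        · rw [sum_eq_zero fun N hN => if_neg fun hs => h ⟨N, hN, hs⟩]
          exact zero_le

/-- The energy of the difference of two consecutive stopped martingales. -/
lemma energy_stopped_sub_le (hm : ∀ k, 2 ≤ m k) {lam : ℕ} (hl : ∀ k, m k ≤ lam)
    (hμ : IsHaar m μ) (hf : IsMartingale m μ f) {p : ℝ} (hp0 : 0 < p) (hp1 : p < 1 / 2)
    (hA0 : 0 ≤ A) (hA : A ≤ A') (L : ℕ) :
    energy μ p (fun x => stopped f A' L x - stopped f A L x) ≤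
      atomConst p lam * ENNReal.ofReal ((A' + A) ^ p) * (lam * μ (levelSet f A)) := by
  classical
  have hp1' : p ≤ 1 := by linarith
  have hpiece : ∀ N ∈ range (L + 1), ∀ c ∈ reps hm N, energy μ p (piece f A A' L N c) ≤
      atomConst p lam * ENNReal.ofReal ((A' + A) ^ p) * (lam *
        if FirstStop f A N c then μ (cylAt m N c ∩ levelSet f A) else 0) := fun N hN c _ => by
    have hNL : N ≤ L := Nat.lt_succ_iff.1 (mem_range.1 hN)
    by_cases h : FirstStop f A N c
    · rw [if_pos h]
      refine (energy_atom_le hm hl hμ hp0 hp1 (dep_piece hf.dep A A' c hNL) (by linarith)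
        (norm_piece_le hA hA0 c) (c := c) (fun y hy => by simp [piece, hy])
        fun hN0 => integral_piece hm hμ hf hA hN0 c).trans ?_
      exact mul_le_mul_right (h.inv_M_le hm hl hμ hf.dep hA0) _
    · have : piece f A A' L N c = fun _ => 0 := by
        funext x
        simp [piece, h]
      rw [this, energy_zero hp0]
      exact zero_le
  rw [show (fun x => stopped f A' L x - stopped f A L x) = fun x => ∑ N ∈ range (L + 1),
    ∑ c ∈ reps hm N, piece f A A' L N c x from funext (stopped_sub_eq_sum hm (hf.dep 0) hA hA0)]
  have hdep : ∀ N ∈ range (L + 1), ∀ c ∈ reps hm N, Dep L (piece f A A' L N c) :=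
    fun N hN c _ => dep_piece hf.dep A A' c (Nat.lt_succ_iff.1 (mem_range.1 hN))
  refine (energy_sum_le hm hμ hp0 hp1' _ (L := L)
    (g := fun N x => ∑ c ∈ reps hm N, piece f A A' L N c x) fun N hN x y hxy =>
    sum_congr rfl fun c hc => hdep N hN c hc x y hxy).trans ?_
  refine (sum_le_sum fun N hN => (energy_sum_le hm hμ hp0 hp1' _ (g := piece f A A' L N)
    (hdep N hN)).trans (sum_le_sum (hpiece N hN))).trans ?_
  simp only [← mul_sum]
  refine mul_le_mul_right (mul_le_mul_right ?_ _) _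
  exact sum_measure_firstStop_le hm hf.dep (measurableSet_levelSet hm hf.dep A) A (L + 1)

end Stopping

end Vilenkin

namespace Vilenkin

section Main

lemma sum_levels_le {p ε : ℝ} (hp0 : 0 < p) (hε : 0 < ε) (y : ℝ≥0∞) (J : ℕ) :
    ∑ i ∈ range J, (if ENNReal.ofReal (ε * 2 ^ i) < y then
      ENNReal.ofReal ((ε * 2 ^ i) ^ p) else 0) ≤
      ENNReal.ofReal (2 ^ p / (2 ^ p - 1)) * y ^ p := by
  have hr : (1 : ℝ) < 2 ^ p := Real.one_lt_rpow (by norm_num) hp0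
  have hr' : (0 : ℝ) < 2 ^ p - 1 := by linarith
  induction J with
  | zero => simp
  | succ J ih =>
    by_cases h : ENNReal.ofReal (ε * 2 ^ J) < y
    · have h1 : ∑ i ∈ range (J + 1), (ε * 2 ^ i) ^ p ≤ 2 ^ p / (2 ^ p - 1) * (ε * 2 ^ J) ^ p := by
        have e : ∀ i : ℕ, (ε * 2 ^ i) ^ p = ε ^ p * (2 ^ p) ^ i := fun i => by
          rw [Real.mul_rpow hε.le (by positivity), Real.rpow_pow_comm (by norm_num)]
        simp only [e]
        rw [← mul_sum, geom_sum_eq hr.ne', mul_left_comm, div_mul_eq_mul_div]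
        gcongr
        rw [pow_succ']
        linarith
      calc _ ≤ ∑ i ∈ range (J + 1), ENNReal.ofReal ((ε * 2 ^ i) ^ p) := by
            refine sum_le_sum fun i _ => ?_
            split_ifs
            · exact le_rfl
            · exact zero_le
        _ ≤ ENNReal.ofReal (2 ^ p / (2 ^ p - 1)) * ENNReal.ofReal (ε * 2 ^ J) ^ p := by
            rw [← ENNReal.ofReal_sum_of_nonneg fun i _ => by positivity,
              ENNReal.ofReal_rpow_of_nonneg (by positivity) hp0.le,
              ← ENNReal.ofReal_mul (by positivity)]
            exact ENNReal.ofReal_le_ofReal h1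
        _ ≤ _ := by gcongr
    · rw [sum_range_succ, if_neg h, add_zero]
      exact ih

/-- The constant in the strong convergence inequality. -/
def mainConst (p : ℝ) (lam : ℕ) : ℝ≥0∞ :=
  atomConst p lam * ENNReal.ofReal (3 ^ p) * lam * ENNReal.ofReal (2 ^ p / (2 ^ p - 1))

lemma mainConst_ne_top {p : ℝ} (hp1 : p < 1 / 2) (lam : ℕ) : mainConst p lam ≠ ⊤ :=
  ENNReal.mul_ne_top (ENNReal.mul_ne_top (ENNReal.mul_ne_top (atomConst_ne_top hp1 lam)
    ENNReal.ofReal_ne_top) (ENNReal.natCast_ne_top _)) ENNReal.ofReal_ne_top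

variable {m : ℕ → ℕ} {μ : Measure (Gm m)} {f : ℕ → Gm m → ℂ}

lemma exists_common_bound (hm : ∀ k, 2 ≤ m k) (hf : ∀ n, Dep n (f n)) (L : ℕ) :
    ∃ R : ℝ, ∀ n ≤ L, ∀ x, ‖f n x‖ ≤ R := by
  choose b hb using fun n => (hf n).exists_bound hm
  refine ⟨∑ n ∈ range (L + 1), |b n|, fun n hn x => ((hb n x).trans (le_abs_self _)).trans ?_⟩
  exact single_le_sum (f := fun n => |b n|) (fun _ _ => abs_nonneg _)
    (mem_range.2 (Nat.lt_succ_of_le hn))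

lemma sum_measure_levelSet_le (hm : ∀ k, 2 ≤ m k) (hf : ∀ n, Dep n (f n)) {p ε : ℝ}
    (hp0 : 0 < p) (hε : 0 < ε) (J : ℕ) :
    ∑ i ∈ range J, ENNReal.ofReal ((ε * 2 ^ i) ^ p) * μ (levelSet f (ε * 2 ^ i)) ≤
      ENNReal.ofReal (2 ^ p / (2 ^ p - 1)) * ∫⁻ x, mstar m f x ^ p ∂μ := by
  have hE : ∀ i : ℕ, MeasurableSet (levelSet f (ε * 2 ^ i)) := fun i =>
    measurableSet_levelSet hm hf _
  have h1 : ∀ i : ℕ, Measurable fun x => ENNReal.ofReal ((ε * 2 ^ i) ^ p) *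
      (levelSet f (ε * 2 ^ i)).indicator 1 x := fun i =>
    (measurable_one.indicator (hE i)).const_mul _
  have h2 : ∀ i : ℕ, ENNReal.ofReal ((ε * 2 ^ i) ^ p) * μ (levelSet f (ε * 2 ^ i)) =
      ∫⁻ x, ENNReal.ofReal ((ε * 2 ^ i) ^ p) * (levelSet f (ε * 2 ^ i)).indicator 1 x ∂μ :=
    fun i => by
      rw [lintegral_const_mul _ (measurable_one.indicator (hE i)), lintegral_indicator_one (hE i)]
  rw [sum_congr rfl fun i _ => h2 i, ← lintegral_finsetSum _ fun i _ => h1 i,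
    ← lintegral_const_mul _ ((measurable_mstar hm hf).pow_const p)]
  refine lintegral_mono fun x => le_trans (sum_le_sum fun i _ => ?_)
    (sum_levels_le hp0 hε (mstar m f x) J)
  by_cases h : x ∈ levelSet f (ε * 2 ^ i)
  · rw [if_pos (show ENNReal.ofReal (ε * 2 ^ i) < mstar m f x from h)]
    simp [h]
  · simp [h]

lemma energy_le_add (hm : ∀ k, 2 ≤ m k) {lam : ℕ} (hl : ∀ k, m k ≤ lam) (hμ : IsHaar m μ)
    (hf : IsMartingale m μ f) {p ε : ℝ} (hp0 : 0 < p) (hp1 : p < 1 / 2) (hε : 0 < ε) (L : ℕ) :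
    energy μ p (f L) ≤ atomConst p lam * ENNReal.ofReal (ε ^ p) +
      mainConst p lam * ∫⁻ x, mstar m f x ^ p ∂μ := by
  have hp1' : p ≤ 1 := by linarith
  obtain ⟨R, hR⟩ := exists_common_bound hm hf.dep (L + 1)
  obtain ⟨J, hJ⟩ := pow_unbounded_of_one_lt (R / ε) (one_lt_two : (1 : ℝ) < 2)
  have hJ' : R ≤ ε * 2 ^ J := by
    rw [div_lt_iff₀' hε] at hJ
    exact hJ.le
  have hdec : f L = fun x => stopped f (ε * 2 ^ 0) L x + ∑ i ∈ range J,
      (stopped f (ε * 2 ^ (i + 1)) L x - stopped f (ε * 2 ^ i) L x) := by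
    funext x
    rw [sum_range_sub (fun i => stopped f (ε * 2 ^ i) L x), add_sub_cancel,
      stopped_eq fun n hn y => (hR n hn y).trans hJ']
  have hdiff : ∀ i ∈ range J, Dep L fun x =>
      stopped f (ε * 2 ^ (i + 1)) L x - stopped f (ε * 2 ^ i) L x := fun i _ =>
    (dep_stopped hf.dep _ L).comp₂ (dep_stopped hf.dep _ L) (· - ·)
  rw [hdec]
  refine (energy_add_le hm hμ hp0 hp1' (L := L) (dep_stopped hf.dep _ L)
    (h := fun x => ∑ i ∈ range J, (stopped f (ε * 2 ^ (i + 1)) L x - stopped f (ε * 2 ^ i) L x))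
    fun x y hxy => sum_congr rfl fun i hi => hdiff i hi x y hxy).trans (add_le_add ?_ ?_)
  · refine (energy_atom_le hm hl hμ hp0 hp1 (N := 0) (c := 0) (dep_stopped hf.dep _ L)
      (A := ε * 2 ^ 0) (by positivity) (norm_stopped_le (by positivity) L)
      (fun y hy => (hy fun k hk => absurd hk k.not_lt_zero).elim)
      fun h => (h rfl).elim).trans_eq ?_
    simp [M]
  · refine (energy_sum_le hm hμ hp0 hp1' (range J)
      (g := fun i x => stopped f (ε * 2 ^ (i + 1)) L x - stopped f (ε * 2 ^ i) L x) hdiff).trans ?_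
    calc _ ≤ ∑ i ∈ range J, atomConst p lam * ENNReal.ofReal (3 ^ p) * lam *
          (ENNReal.ofReal ((ε * 2 ^ i) ^ p) * μ (levelSet f (ε * 2 ^ i))) := by
          refine sum_le_sum fun i _ => ?_
          refine (energy_stopped_sub_le hm hl hμ hf hp0 hp1 (by positivity) (by
            gcongr
            · norm_num
            · exact i.le_succ) L).trans_eq ?_
          have e : (ε * 2 ^ (i + 1) + ε * 2 ^ i) ^ p = 3 ^ p * (ε * 2 ^ i) ^ p := by
            rw [← Real.mul_rpow (by norm_num) (by positivity)]
            congr 1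
            ring
          rw [e, ENNReal.ofReal_mul (by positivity)]
          ring
      _ ≤ _ := by
          rw [← mul_sum, mainConst, mul_assoc _ (ENNReal.ofReal (2 ^ p / (2 ^ p - 1)))]
          exact mul_le_mul_right (sum_measure_levelSet_le hm hf.dep hp0 hε J) _

/-- The strong convergence inequality for a single martingale term. -/
lemma energy_le (hm : ∀ k, 2 ≤ m k) {lam : ℕ} (hl : ∀ k, m k ≤ lam) (hμ : IsHaar m μ)
    (hf : IsMartingale m μ f) {p : ℝ} (hp0 : 0 < p) (hp1 : p < 1 / 2) (L : ℕ) :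
    energy μ p (f L) ≤ mainConst p lam * ∫⁻ x, mstar m f x ^ p ∂μ := by
  have hlim : Filter.Tendsto (fun δ : ℝ => atomConst p lam * ENNReal.ofReal δ +
      mainConst p lam * ∫⁻ x, mstar m f x ^ p ∂μ) (nhdsWithin 0 (Set.Ioi 0))
      (nhds (atomConst p lam * ENNReal.ofReal 0 +
        mainConst p lam * ∫⁻ x, mstar m f x ^ p ∂μ)) :=
    ((ENNReal.Tendsto.const_mul ((ENNReal.continuous_ofReal.tendsto 0).mono_left
      nhdsWithin_le_nhds) (Or.inr (atomConst_ne_top hp1 lam))).add tendsto_const_nhds)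
  rw [ENNReal.ofReal_zero, mul_zero, zero_add] at hlim
  refine ge_of_tendsto hlim (Filter.eventually_of_mem self_mem_nhdsWithin fun δ hδ => ?_)
  have hδ : 0 < δ := hδ
  have := energy_le_add hm hl hμ hf hp0 hp1 (Real.rpow_pos_of_pos hδ (1 / p)) L
  rwa [← Real.rpow_mul hδ.le, one_div_mul_cancel hp0.ne', Real.rpow_one] at this

end Main

end Vilenkin

/-- strong convergence of Fejér means: for `0 < p < 1/2` there is
`c_p > 0` (depending only on `p` and `λ = sup m_k`) with
`∑_{k=1}^∞ ‖σ_k f‖_{L_p}^p / k^{2-2p} ≤ c_p ‖f‖_{H_p}^p` for every martingale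
`f ∈ H_p`. -/
theorem statement16 (p : ℝ) (hp0 : 0 < p) (hp1 : p < 1 / 2) (lam : ℕ) :
    ∃ c : ℝ, 0 < c ∧
      ∀ (m : ℕ → ℕ), (∀ k, 2 ≤ m k) → (∀ k, m k ≤ lam) →
      ∀ (μ : Measure (Gm m)), Vilenkin.IsHaar m μ →
      ∀ (f : ℕ → Gm m → ℂ), Vilenkin.IsMartingale m μ f → Vilenkin.MemHp m μ p f →
        ∑' k : ℕ,
            (∫⁻ x, (‖Vilenkin.sigma m μ f (k + 1) x‖₊ : ℝ≥0∞) ^ p ∂μ) /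
              ((k + 1 : ℕ) : ℝ≥0∞) ^ (2 - 2 * p) ≤
          ENNReal.ofReal c * ∫⁻ x, Vilenkin.mstar m f x ^ p ∂μ := by
  refine ⟨(Vilenkin.mainConst p lam).toReal + 1, by positivity, ?_⟩
  intro m hm hl μ hμ f hf _
  have hc : Vilenkin.mainConst p lam ≤
      ENNReal.ofReal ((Vilenkin.mainConst p lam).toReal + 1) := by
    refine (ENNReal.ofReal_toReal (Vilenkin.mainConst_ne_top hp1 lam)).symm.trans_le ?_
    exact ENNReal.ofReal_le_ofReal (by linarith)
  refine ENNReal.tsum_le_of_sum_range_le fun n => ?_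
  refine le_trans ?_ ((Vilenkin.energy_le hm hl hμ hf hp0 hp1 n).trans (mul_le_mul_left hc _))
  refine le_trans (Finset.sum_le_sum fun k hk => ?_) (ENNReal.sum_le_tsum (Finset.range n))
  simp only [Vilenkin.sigma_eq_fejerMean hm hμ hf (Nat.succ_le_of_lt (Finset.mem_range.1 hk))]
  exact le_rfl
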